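/- arXiv:2509.07765 — 2 statements merged into one kernel-verified Lean document; each statement's English description precedes it below -/
import Mathlib

section
/- There is an absolute constant C > 0 such that for every prime p and every generalized arithmetic progression A ⊆ F_p of rank 2, the multiplicative energy satisfies E_×(A) ≤ C · (|A|² + |A|⁴/p) · log p. -/
open Finset

/-- The multiplicative energy of a finite subset `S` of `F_p`:
the number of quadruples `(s₁, s₂, s₃, s₄) ∈ S⁴` with `s₁s₂ = s₃s₄`. -/
def multEnergy {p : ℕ} (S : Finset (ZMod p)) : ℕ :=
  (((S ×ˢ S) ×ˢ (S ×ˢ S)).filter (fun q => q.1.1 * q.1.2 = q.2.1 * q.2.2)).card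

/-- Subtracting integer combinations of a set of bounded vectors to make a vector small. -/
theorem exists_sub_mem_span_of_smul_sub_mem {ι : Type*} (I : Finset (ι → ℤ)) (h : ι → ℤ)
    (hI : ∀ v ∈ I, ∀ i, |v i| ≤ h i) {M : ℤ} (hM : M ≠ 0) {z w : ι → ℤ}
    (hz : M • z - w ∈ Submodule.span ℤ (I : Set (ι → ℤ))) :
    ∃ z', z' - z ∈ Submodule.span ℤ (I : Set (ι → ℤ)) ∧
      ∀ i, |M| * |z' i| ≤ |w i| + |M| * (I.card * h i) := by
  obtain ⟨f, -, hf⟩ := Submodule.mem_span_finset.1 hz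
  refine ⟨z - ∑ a ∈ I, (f a / M) • a, ?_, fun i => ?_⟩
  · rw [sub_sub_cancel_left]
    exact neg_mem (sum_mem fun a ha =>
      Submodule.smul_mem _ _ (Submodule.subset_span (by exact_mod_cast ha)))
  · have hfi := congrFun hf i
    simp only [Finset.sum_apply, Pi.smul_apply, smul_eq_mul, Pi.sub_apply] at hfi ⊢
    have key : M * (z i - ∑ a ∈ I, f a / M * a i) = w i + ∑ a ∈ I, (f a % M) * a i := by
      have h2 : ∑ a ∈ I, f a * a i
          = M * ∑ a ∈ I, f a / M * a i + ∑ a ∈ I, (f a % M) * a i := by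
        rw [Finset.mul_sum, ← Finset.sum_add_distrib]
        refine Finset.sum_congr rfl fun a _ => ?_
        have := Int.mul_ediv_add_emod (f a) M
        linear_combination (-a i) * this
      linear_combination -hfi + h2
    rw [← abs_mul, key]
    refine (abs_add_le _ _).trans (add_le_add le_rfl ?_)
    refine (Finset.abs_sum_le_sum_abs _ _).trans ?_
    calc ∑ a ∈ I, |f a % M * a i| ≤ ∑ a ∈ I, |M| * h i := by
          refine Finset.sum_le_sum fun a ha => ?_
          rw [abs_mul]
          refine mul_le_mul ?_ (hI a ha i) (abs_nonneg _) (abs_nonneg _)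
          rw [abs_of_nonneg (Int.emod_nonneg _ hM)]
          exact (Int.emod_lt_abs _ hM).le
      _ = |M| * (I.card * h i) := by simp; ring

/-- A finite set of integer vectors contains a small subset spanning it up to torsion. -/
theorem exists_subset_card_le_smul_mem_span {ι : Type*} [Fintype ι] (S : Finset (ι → ℤ)) :
    ∃ I ⊆ S, I.card ≤ Fintype.card ι ∧ ∀ x ∈ Submodule.span ℤ (S : Set (ι → ℤ)),
      ∃ N : ℤ, N ≠ 0 ∧ N • x ∈ Submodule.span ℤ (I : Set (ι → ℤ)) := by
  classical
  obtain ⟨s, hs, hmax⟩ := exists_maximal_linearIndepOn ℤ (fun x : S => (x : ι → ℤ))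
  set I : Finset (ι → ℤ) := Finset.univ.filter (fun x : S => x ∈ s) |>.image Subtype.val with hIdef
  have hIs : (I : Set (ι → ℤ)) = (fun x : S => (x : ι → ℤ)) '' s := by
    ext v; simp [hIdef]
  refine ⟨I, ?_, ?_, fun x hx => ?_⟩
  · intro v hv
    simp only [hIdef, Finset.mem_image, Finset.mem_filter] at hv
    obtain ⟨y, -, rfl⟩ := hv
    exact y.2
  · have h1 : LinearIndependent ℤ (fun x : I => (x : ι → ℤ)) := by
      have := hs.id_image
      rw [← hIs] at this
      exact this
    have := h1.finset_card_le_finrank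
    simpa using this
  · refine Submodule.span_induction (p := fun x _ => ∃ N : ℤ, N ≠ 0 ∧
      N • x ∈ Submodule.span ℤ (I : Set (ι → ℤ))) ?_ ?_ ?_ ?_ hx
    · intro x hx
      by_cases hxs : (⟨x, by exact_mod_cast hx⟩ : S) ∈ s
      · refine ⟨1, one_ne_zero, ?_⟩
        rw [one_smul, hIs]
        exact Submodule.subset_span ⟨_, hxs, rfl⟩
      · obtain ⟨a, ha, hb⟩ := hmax _ hxs
        exact ⟨a, ha, by rw [hIs]; exact hb⟩
    · exact ⟨1, one_ne_zero, by simp⟩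
    · rintro x y - - ⟨a, ha, hx⟩ ⟨b, hb, hy⟩
      refine ⟨a * b, mul_ne_zero ha hb, ?_⟩
      have : (a * b) • (x + y) = b • (a • x) + a • (b • y) := by
        rw [smul_add, smul_smul, smul_smul, mul_comm b a]
      rw [this]
      exact add_mem (Submodule.smul_mem _ _ hx) (Submodule.smul_mem _ _ hy)
    · rintro c x - ⟨a, ha, hx⟩
      refine ⟨a, ha, ?_⟩
      rw [smul_comm]
      exact Submodule.smul_mem _ _ hx

/-- The integer points of a box. -/
noncomputable def intBox {ι : Type*} [Fintype ι] [DecidableEq ι] (h : ι → ℕ) : Finset (ι → ℤ) :=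
  Fintype.piFinset fun i => Finset.Icc (-(h i : ℤ)) (h i)

theorem mem_intBox {ι : Type*} [Fintype ι] [DecidableEq ι] {h : ι → ℕ} {x : ι → ℤ} :
    x ∈ intBox h ↔ ∀ i, |x i| ≤ h i := by
  simp [intBox, abs_le]

theorem card_intBox {ι : Type*} [Fintype ι] [DecidableEq ι] (h : ι → ℕ) :
    (intBox h).card = ∏ i, (2 * h i + 1) := by
  rw [intBox, Fintype.card_piFinset]
  refine Finset.prod_congr rfl fun i _ => ?_
  rw [Int.card_Icc]; lia

/-- If a map `f` kills a set `S` of points of a box and is injective on a set `J` of vectors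
which are small modulo the rational span of `S`, then `S` has at most `|box| / |J|` points. -/
theorem card_mul_card_le_of_smul_sub_mem_span {ι X : Type*} [Fintype ι] [DecidableEq ι]
    [AddCommGroup X] (S J : Finset (ι → ℤ)) (h : ι → ℕ) (hS : S ⊆ intBox h)
    (hh : ∀ i, 1 ≤ h i) (f : (ι → ℤ) →+ X) (hf : ∀ x ∈ S, f x = 0) (hJ : Set.InjOn f J)
    (hsp : ∀ z ∈ J, ∃ M : ℤ, M ≠ 0 ∧ ∃ w : ι → ℤ,
      M • z - w ∈ Submodule.span ℤ (S : Set (ι → ℤ)) ∧ ∀ i, |w i| ≤ |M| * h i) :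
    S.card * J.card ≤ (2 * Fintype.card ι + 5) ^ Fintype.card ι * ∏ i, h i := by
  obtain ⟨I, hIS, hIc, hI⟩ := exists_subset_card_le_smul_mem_span S
  have hspan : ∀ x ∈ Submodule.span ℤ (S : Set (ι → ℤ)), f x = 0 := by
    intro x hx
    refine Submodule.span_induction (p := fun x _ => f x = 0) ?_ (map_zero f) ?_ ?_ hx
    · exact fun x hx => hf x (by exact_mod_cast hx)
    · intro x y _ _ hx hy; rw [map_add, hx, hy, add_zero]
    · intro a x _ hx; rw [map_zsmul, hx, smul_zero]
  have hIspan : Submodule.span ℤ (I : Set (ι → ℤ)) ≤ Submodule.span ℤ (S : Set (ι → ℤ)) :=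
    Submodule.span_mono (by exact_mod_cast hIS)
  have hred : ∀ z ∈ J, ∃ z', f z' = f z ∧ ∀ i, |z' i| ≤ (1 + Fintype.card ι) * h i := by
    intro z hz
    obtain ⟨M, hM, w, hw, hwb⟩ := hsp z hz
    obtain ⟨N, hN, hNw⟩ := hI _ hw
    have hNw' : (N * M) • z - N • w ∈ Submodule.span ℤ (I : Set (ι → ℤ)) := by
      rwa [smul_sub, smul_smul] at hNw
    obtain ⟨z', hz', hb⟩ := exists_sub_mem_span_of_smul_sub_mem I (fun i => (h i : ℤ))
      (fun v hv => mem_intBox.1 (hS (hIS hv))) (mul_ne_zero hN hM) hNw'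
    refine ⟨z', ?_, fun i => ?_⟩
    · rw [← sub_eq_zero, ← map_sub]; exact hspan _ (hIspan hz')
    · have h1 := hb i
      have h2 := hwb i
      have h3 : (0 : ℤ) < |N * M| := abs_pos.2 (mul_ne_zero hN hM)
      refine le_of_mul_le_mul_left (h1.trans ?_) h3
      have h4 : |(N • w) i| ≤ |N * M| * h i := by
        rw [Pi.smul_apply, smul_eq_mul, abs_mul, abs_mul, mul_assoc]
        exact mul_le_mul_of_nonneg_left h2 (abs_nonneg _)
      have h5 : (I.card : ℤ) * h i ≤ Fintype.card ι * h i := by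
        exact_mod_cast Nat.mul_le_mul_right _ hIc
      nlinarith [mul_le_mul_of_nonneg_left h5 h3.le]
  choose! r hr hrb using hred
  have hcard : (S ×ˢ J).card ≤ (intBox fun i => (2 + Fintype.card ι) * h i).card := by
    refine Finset.card_le_card_of_injOn (fun q => q.1 + r q.2) ?_ ?_
    · rintro ⟨x, z⟩ hq
      obtain ⟨hx, hz⟩ := Finset.mem_product.1 (Finset.mem_coe.1 hq)
      refine Finset.mem_coe.2 (mem_intBox.2 fun i => ?_)
      have h1 := mem_intBox.1 (hS hx) i
      have h2 := hrb z hz i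
      have h3 := abs_add_le (x i) (r z i)
      push_cast
      simp only [Pi.add_apply]
      dsimp only at h1 h2
      linarith
    · rintro ⟨x, z⟩ hq ⟨x', z'⟩ hq' heq
      obtain ⟨hx, hz⟩ := Finset.mem_product.1 (Finset.mem_coe.1 hq)
      obtain ⟨hx', hz'⟩ := Finset.mem_product.1 (Finset.mem_coe.1 hq')
      dsimp only at heq hx hz hx' hz'
      have h1 := congrArg f heq
      rw [map_add, map_add, hf x hx, hf x' hx', hr z hz, hr z' hz', zero_add, zero_add] at h1
      have h2 := hJ (Finset.mem_coe.2 hz) (Finset.mem_coe.2 hz') h1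
      subst h2
      simpa using heq
  rw [Finset.card_product, card_intBox] at hcard
  refine hcard.trans ?_
  calc ∏ i, (2 * ((2 + Fintype.card ι) * h i) + 1)
      ≤ ∏ i, ((2 * Fintype.card ι + 5) * h i) := by
        refine Finset.prod_le_prod' fun i _ => ?_
        have := hh i
        nlinarith
    _ = _ := by rw [Finset.prod_mul_distrib]; simp

/-- Special case of a map to `ZMod p` not vanishing on the rational span of `S`. -/
theorem card_mul_prime_le_of_smul_mem_span {ι : Type*} [Fintype ι] [DecidableEq ι]
    {p : ℕ} [Fact p.Prime] (S : Finset (ι → ℤ)) (h : ι → ℕ) (hS : S ⊆ intBox h)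
    (hh : ∀ i, 1 ≤ h i) (f : (ι → ℤ) →+ ZMod p) (hf : ∀ x ∈ S, f x = 0)
    {z : ι → ℤ} (hz : f z ≠ 0) {N : ℤ} (hN : N ≠ 0)
    (hNz : N • z ∈ Submodule.span ℤ (S : Set (ι → ℤ))) :
    S.card * p ≤ (2 * Fintype.card ι + 5) ^ Fintype.card ι * ∏ i, h i := by
  have hinj : Set.InjOn (fun j : ℕ => f ((j : ℤ) • z)) (Finset.range p) := by
    intro i hi j hj hij
    simp only [Finset.coe_range, Set.mem_Iio] at hi hj
    dsimp only at hij
    rw [map_zsmul, map_zsmul, zsmul_eq_mul, zsmul_eq_mul] at hij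
    have := mul_right_cancel₀ hz hij
    push_cast at this
    have h2 := congrArg ZMod.val this
    rwa [ZMod.val_natCast_of_lt hi, ZMod.val_natCast_of_lt hj] at h2
  have hinj' : Set.InjOn (fun j : ℕ => (j : ℤ) • z) (Finset.range p) := by
    intro i hi j hj hij
    exact hinj hi hj (congrArg f hij)
  have := card_mul_card_le_of_smul_sub_mem_span S
    ((Finset.range p).image fun j : ℕ => (j : ℤ) • z) h hS hh f hf ?_ ?_
  · rwa [Finset.card_image_of_injOn hinj', Finset.card_range] at this
  · rw [Finset.coe_image]
    rintro _ ⟨i, hi, rfl⟩ _ ⟨j, hj, rfl⟩ hij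
    rw [hinj hi hj hij]
  · intro y hy
    obtain ⟨j, -, rfl⟩ := Finset.mem_image.1 hy
    refine ⟨N, hN, 0, ?_, fun i => by simp; positivity⟩
    rw [sub_zero, smul_comm]
    exact Submodule.smul_mem _ _ hNz

/-- A set of `B`-separated integers in `[-R, R]` has at most `2R/B + 1` elements. -/
theorem card_mul_le_of_separated {α : Type*} (T : Finset α) (g : α → ℤ) (R : ℤ) {B : ℤ}
    (hB : 0 < B) (hR0 : 0 ≤ R) (hR : ∀ n ∈ T, |g n| ≤ R)
    (hsep : ∀ n ∈ T, ∀ n' ∈ T, n ≠ n' → B ≤ |g n - g n'|) :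
    T.card * B ≤ 2 * R + B := by
  have h1 : T.card ≤ (Finset.Icc (0 : ℤ) (2 * R / B)).card := by
    refine Finset.card_le_card_of_injOn (fun n => (g n + R) / B) ?_ ?_
    · intro n hn
      have := abs_le.1 (hR n hn)
      refine Finset.mem_coe.2 (Finset.mem_Icc.2 ⟨Int.ediv_nonneg (by linarith) hB.le, ?_⟩)
      exact Int.ediv_le_ediv hB (by linarith)
    · intro n hn n' hn' heq
      by_contra hne
      have h2 := hsep n hn n' hn' hne
      dsimp only at heq
      have e1 := Int.mul_ediv_add_emod (g n + R) B
      have e2 := Int.mul_ediv_add_emod (g n' + R) B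
      have l1 := Int.emod_lt_of_pos (g n + R) hB
      have l2 := Int.emod_lt_of_pos (g n' + R) hB
      have m1 := Int.emod_nonneg (g n + R) hB.ne'
      have m2 := Int.emod_nonneg (g n' + R) hB.ne'
      rw [heq] at e1
      have : |g n - g n'| < B := by rw [abs_lt]; constructor <;> linarith
      linarith
  rw [Int.card_Icc, sub_zero] at h1
  have h3 : (0 : ℤ) ≤ 2 * R / B := Int.ediv_nonneg (by linarith) hB.le
  have h4 : (T.card : ℤ) ≤ 2 * R / B + 1 := by lia
  have h5 := Int.ediv_mul_le (2 * R) hB.ne'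
  nlinarith

theorem card_mul_le_of_dominated {α : Type*} (T : Finset α) (g k : α → ℤ) (R : ℤ) {H₁ H₂ : ℤ}
    (hR0 : 0 ≤ R) (hH₁ : 0 < H₁) (hH₂ : 0 < H₂) (hR : ∀ n ∈ T, |g n| * H₁ ≤ R)
    (hdom : ∀ n ∈ T, ∀ n' ∈ T, |k n - k n'| * H₂ ≤ |g n - g n'| * H₁)
    (hsep : ∀ n ∈ T, ∀ n' ∈ T, n ≠ n' → H₂ ≤ |g n - g n'| ∨ H₁ ≤ |k n - k n'|) :
    T.card * (H₁ * H₂) ≤ 2 * R + H₁ * H₂ := by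
  have := card_mul_le_of_separated T (fun n => H₁ * g n) R (mul_pos hH₁ hH₂) hR0
    (fun n hn => by rw [abs_mul, abs_of_pos hH₁, mul_comm]; exact hR n hn)
    (fun n hn n' hn' hne => by
      rw [← mul_sub, abs_mul, abs_of_pos hH₁]
      refine mul_le_mul_of_nonneg_left ?_ hH₁.le
      rcases hsep n hn n' hn' hne with h | h
      · exact h
      · have := hdom n hn n' hn'
        nlinarith)
  exact this

theorem dominated_of_proportional {u₀ u₁ d₀ d₁ H₁ H₂ : ℤ} (hu : u₀ ≠ 0)
    (h : |u₁| * H₂ ≤ |u₀| * H₁) (hd : u₀ * d₁ = u₁ * d₀) : |d₁| * H₂ ≤ |d₀| * H₁ := by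
  have h1 := congrArg abs hd
  rw [abs_mul, abs_mul] at h1
  have h2 : 0 < |u₀| := abs_pos.2 hu
  refine le_of_mul_le_mul_left ?_ h2
  have h3 := mul_le_mul_of_nonneg_right h (abs_nonneg d₀)
  calc |u₀| * (|d₁| * H₂) = |u₁| * H₂ * |d₀| := by rw [← mul_assoc, h1]; ring
    _ ≤ _ := h3
    _ = _ := by ring

/-- The image of the box `{|x₁| < H₁, |x₂| < H₂}` under `(x₁, x₂) ↦ a₁x₁ + a₂x₂` has no
nontrivial zeros. -/
def IsProperBox {p : ℕ} (a₁ a₂ : ZMod p) (H₁ H₂ : ℕ) : Prop :=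
  ∀ x₁ x₂ : ℤ, |x₁| < H₁ → |x₂| < H₂ → a₁ * x₁ + a₂ * x₂ = 0 → x₁ = 0 ∧ x₂ = 0

theorem IsProperBox.le_or_le {p : ℕ} {a₁ a₂ : ZMod p} {H₁ H₂ : ℕ} (hP : IsProperBox a₁ a₂ H₁ H₂)
    {n₀ n₁ : ℤ} (h : a₁ * n₁ = a₂ * n₀) (hne : n₀ ≠ 0 ∨ n₁ ≠ 0) :
    (H₂ : ℤ) ≤ |n₀| ∨ (H₁ : ℤ) ≤ |n₁| := by
  by_contra! hlt
  have := hP n₁ (-n₀) hlt.2 (by rw [abs_neg]; exact hlt.1) (by push_cast; linear_combination h)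
  lia

/-- The number of multiples of `(a₁, a₂)` modulo `p` lying in the box
`|n₀| ≤ R / H₁`, `|n₁| ≤ R / H₂`, when `(a₁, a₂)` is proper on `H₁ × H₂`. -/
theorem card_dual_mul_le {p : ℕ} [Fact p.Prime] {a₁ a₂ : ZMod p} (ha₂ : a₂ ≠ 0) {H₁ H₂ : ℕ}
    (hH₁ : 0 < H₁) (hH₂ : 0 < H₂) (hP : IsProperBox a₁ a₂ H₁ H₂) {R : ℕ} (hR : R ≤ p)
    (T : Finset (Fin 2 → ℤ)) (hT : ∀ n ∈ T, n 0 ≠ 0 ∧ n 1 ≠ 0)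
    (hT0 : ∀ n ∈ T, |n 0| * H₁ ≤ R) (hT1 : ∀ n ∈ T, |n 1| * H₂ ≤ R)
    (hTa : ∀ n ∈ T, a₁ * (n 1 : ℤ) = a₂ * (n 0 : ℤ)) :
    T.card * (H₁ * H₂) ≤ 81 * R := by
  have hH₁' : (0 : ℤ) < H₁ := by exact_mod_cast hH₁
  have hH₂' : (0 : ℤ) < H₂ := by exact_mod_cast hH₂
  rcases T.eq_empty_or_nonempty with rfl | ⟨u, hu⟩
  · simp
  have hu0 : 1 ≤ |u 0| := Int.one_le_abs (hT u hu).1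
  have hu1 : 1 ≤ |u 1| := Int.one_le_abs (hT u hu).2
  by_cases hprop : ∀ n ∈ T, u 0 * n 1 = u 1 * n 0
  · have hRH : (H₁ * H₂ : ℤ) ≤ R := by
      rcases hP.le_or_le (hTa u hu) (Or.inl (hT u hu).1) with h | h
      · have := hT0 u hu; nlinarith
      · have := hT1 u hu; nlinarith
    have hsep : ∀ n ∈ T, ∀ n' ∈ T, n ≠ n' →
        (H₂ : ℤ) ≤ |n 0 - n' 0| ∨ (H₁ : ℤ) ≤ |n 1 - n' 1| := by
      intro n hn n' hn' hne
      refine hP.le_or_le ?_ ?_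
      · push_cast
        linear_combination hTa n hn - hTa n' hn'
      · by_contra! h
        refine hne (funext fun i => ?_)
        fin_cases i
        · exact sub_eq_zero.1 h.1
        · exact sub_eq_zero.1 h.2
    have key : (T.card : ℤ) * (H₁ * H₂) ≤ 2 * R + H₁ * H₂ := by
      rcases le_total (|u 1| * (H₂ : ℤ)) (|u 0| * H₁) with hd | hd
      · exact card_mul_le_of_dominated T (fun n => n 0) (fun n => n 1) R (by positivity) hH₁' hH₂'
          hT0 (fun n hn n' hn' => dominated_of_proportional (hT u hu).1 hd
            (by linear_combination hprop n hn - hprop n' hn')) hsep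
      · have := card_mul_le_of_dominated T (fun n => n 1) (fun n => n 0) R (by positivity)
          hH₂' hH₁'
          hT1 (fun n hn n' hn' => dominated_of_proportional (hT u hu).2 hd
            (by linear_combination hprop n' hn' - hprop n hn))
          (fun n hn n' hn' hne => (hsep n hn n' hn' hne).symm)
        linarith
    have : (T.card : ℤ) * (H₁ * H₂) ≤ 81 * R := by linarith
    exact_mod_cast this
  · push Not at hprop
    obtain ⟨v, hv, hdet⟩ := hprop
    let f : (Fin 2 → ℤ) →+ ZMod p :=
      { toFun := fun n => a₁ * (n 1 : ℤ) - a₂ * (n 0 : ℤ)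
        map_zero' := by simp
        map_add' := fun x y => by push_cast [Pi.add_apply]; ring }
    have hdiv : ∀ {H : ℕ} {n : ℤ}, 0 < H → |n| * H ≤ R → |n| ≤ ((R / H : ℕ) : ℤ) := by
      intro H n hH hn
      push_cast
      exact (Int.le_ediv_iff_mul_le (by exact_mod_cast hH)).2 hn
    have hb : ∀ n ∈ T, ∀ i, |n i| ≤ ((![R / H₁, R / H₂] i : ℕ) : ℤ) := by
      intro n hn i
      fin_cases i
      · exact hdiv hH₁ (hT0 n hn)
      · exact hdiv hH₂ (hT1 n hn)
    have hmem : (u 0 * v 1 - u 1 * v 0) • (![1, 0] : Fin 2 → ℤ)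
        ∈ Submodule.span ℤ (T : Set (Fin 2 → ℤ)) := by
      have : (u 0 * v 1 - u 1 * v 0) • (![1, 0] : Fin 2 → ℤ) = v 1 • u - u 1 • v := by
        ext i; fin_cases i <;> simp <;> ring
      rw [this]
      exact sub_mem (Submodule.smul_mem _ _ (Submodule.subset_span hu))
        (Submodule.smul_mem _ _ (Submodule.subset_span hv))
    have := card_mul_prime_le_of_smul_mem_span T ![R / H₁, R / H₂]
      (fun n hn => mem_intBox.2 (hb n hn)) (fun i => by
        have h1 := hb u hu i
        fin_cases i
        · exact_mod_cast hu0.trans h1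
        · exact_mod_cast hu1.trans h1) f
      (fun n hn => sub_eq_zero.2 (hTa n hn)) (z := ![1, 0]) (by simpa [f] using ha₂)
      (sub_ne_zero.2 hdet) hmem
    simp only [Fintype.card_fin, Fin.prod_univ_two, Matrix.cons_val_zero, Matrix.cons_val_one] at this
    have hp : 0 < p := (Fact.out : p.Prime).pos
    refine Nat.le_of_mul_le_mul_left ?_ hp
    have e1 := Nat.div_mul_le_self R H₁
    have e2 := Nat.div_mul_le_self R H₂
    calc p * (T.card * (H₁ * H₂)) = (T.card * p) * (H₁ * H₂) := by ring
      _ ≤ ((2 * 2 + 5) ^ 2 * (R / H₁ * (R / H₂))) * (H₁ * H₂) := Nat.mul_le_mul_right _ this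
      _ = 81 * ((R / H₁ * H₁) * (R / H₂ * H₂)) := by ring
      _ ≤ 81 * (R * R) := by gcongr
      _ ≤ 81 * (p * R) := by gcongr
      _ = _ := by ring

/-- The form `z ↦ (a₁z₀ + a₂z₁) - c(a₁z₂ + a₂z₃)` on `ℤ⁴` with values in `ZMod p`. -/
def ratioForm {p : ℕ} (a₁ a₂ c : ZMod p) : (Fin 4 → ℤ) →+ ZMod p where
  toFun z := a₁ * (z 0 : ℤ) + a₂ * (z 1 : ℤ) - c * (a₁ * (z 2 : ℤ) + a₂ * (z 3 : ℤ))
  map_zero' := by simp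
  map_add' x y := by push_cast [Pi.add_apply]; ring

theorem ratioForm_apply {p : ℕ} (a₁ a₂ c : ZMod p) (z : Fin 4 → ℤ) :
    ratioForm a₁ a₂ c z =
      a₁ * (z 0 : ℤ) + a₂ * (z 1 : ℤ) - c * (a₁ * (z 2 : ℤ) + a₂ * (z 3 : ℤ)) := rfl

/-- The zeros of `ratioForm` in the box with sides `H₁, H₂, H₁, H₂`. -/
noncomputable def ratioPoints {p : ℕ} (a₁ a₂ c : ZMod p) (H₁ H₂ : ℕ) : Finset (Fin 4 → ℤ) :=
  (intBox ![H₁ - 1, H₂ - 1, H₁ - 1, H₂ - 1]).filter fun z => ratioForm a₁ a₂ c z = 0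

theorem mem_ratioPoints {p : ℕ} {a₁ a₂ c : ZMod p} {H₁ H₂ : ℕ} (hH₁ : 0 < H₁) (hH₂ : 0 < H₂)
    {z : Fin 4 → ℤ} : z ∈ ratioPoints a₁ a₂ c H₁ H₂ ↔
      (∀ i, |z i| < (![H₁, H₂, H₁, H₂] i : ℕ)) ∧ ratioForm a₁ a₂ c z = 0 := by
  rw [ratioPoints, Finset.mem_filter, mem_intBox]
  refine and_congr_left fun _ => forall_congr' fun i => ?_
  fin_cases i <;> simp <;> lia

theorem ratioPoints_subset {p : ℕ} {a₁ a₂ c : ZMod p} {H₁ H₂ : ℕ} (hH₁ : 0 < H₁) (hH₂ : 0 < H₂) :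
    ratioPoints a₁ a₂ c H₁ H₂ ⊆ intBox ![H₁, H₂, H₁, H₂] := fun _ hz =>
  mem_intBox.2 fun i => (((mem_ratioPoints hH₁ hH₂).1 hz).1 i).le

theorem prod_sides (H₁ H₂ : ℕ) : ∏ i, (![H₁, H₂, H₁, H₂] i : ℕ) = (H₁ * H₂) ^ 2 := by
  simp [Fin.prod_univ_four]; ring

theorem sides_pos {H₁ H₂ : ℕ} (hH₁ : 0 < H₁) (hH₂ : 0 < H₂) (i : Fin 4) :
    1 ≤ (![H₁, H₂, H₁, H₂] i : ℕ) := by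
  fin_cases i <;> simpa

/-- If there are many points, then the form vanishes on their rational span. -/
theorem ratioForm_eq_zero_of_smul_mem_span {p : ℕ} [Fact p.Prime] {a₁ a₂ c : ZMod p} {H₁ H₂ : ℕ}
    (hH₁ : 0 < H₁) (hH₂ : 0 < H₂)
    (hK : 13 ^ 4 * (H₁ * H₂) ^ 2 < (ratioPoints a₁ a₂ c H₁ H₂).card * p)
    {z : Fin 4 → ℤ} {N : ℤ} (hN : N ≠ 0)
    (hz : N • z ∈ Submodule.span ℤ (ratioPoints a₁ a₂ c H₁ H₂ : Set (Fin 4 → ℤ))) :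
    ratioForm a₁ a₂ c z = 0 := by
  by_contra h
  have := card_mul_prime_le_of_smul_mem_span _ ![H₁, H₂, H₁, H₂] (ratioPoints_subset hH₁ hH₂)
    (sides_pos hH₁ hH₂) (ratioForm a₁ a₂ c)
    (fun x hx => ((mem_ratioPoints hH₁ hH₂).1 hx).2) h hN hz
  rw [prod_sides, Fintype.card_fin] at this
  exact absurd (this.trans_lt' hK) (lt_irrefl _)

/-- A submodule of `ℤ⁴` of rank at least three is, up to torsion, everything or the kernel of a
surjective functional. -/
theorem exists_functional_of_three_le_finrank (L : Submodule ℤ (Fin 4 → ℤ))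
    (hL : 3 ≤ Module.finrank ℤ L) :
    (∀ z, ∃ N : ℤ, N ≠ 0 ∧ N • z ∈ L) ∨
      ∃ f : (Fin 4 → ℤ) →ₗ[ℤ] ℤ, Function.Surjective f ∧ (∀ z ∈ L, f z = 0) ∧
        ∀ z, f z = 0 → ∃ N : ℤ, N ≠ 0 ∧ N • z ∈ L := by
  set Q := ((Fin 4 → ℤ) ⧸ L) ⧸ Submodule.torsion ℤ ((Fin 4 → ℤ) ⧸ L)
  let π : (Fin 4 → ℤ) →ₗ[ℤ] Q := (Submodule.mkQ _).comp L.mkQ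
  have hπ : Function.Surjective π := (Submodule.mkQ_surjective _).comp (Submodule.mkQ_surjective _)
  have hker : ∀ z, π z = 0 → ∃ N : ℤ, N ≠ 0 ∧ N • z ∈ L := by
    intro z hz
    have h1 := (Submodule.Quotient.mk_eq_zero _).1 hz
    obtain ⟨N, hN⟩ := (Submodule.mem_torsion_iff _).1 h1
    refine ⟨N, nonZeroDivisors.coe_ne_zero N, ?_⟩
    exact (Submodule.Quotient.mk_eq_zero _).1 hN
  have hrank : Module.finrank ℤ Q + Module.finrank ℤ L = 4 := by
    have h1 := Submodule.finrank_quotient_add_finrank L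
    have h2 : Module.finrank ℤ Q = Module.finrank ℤ ((Fin 4 → ℤ) ⧸ L) :=
      congrArg Cardinal.toNat (rank_quotient_eq_of_le_torsion le_rfl)
    rw [h2, h1]; simp
  rcases (by lia : Module.finrank ℤ Q = 0 ∨ Module.finrank ℤ Q = 1) with h0 | h1
  · left
    intro z
    have := Module.finrank_zero_iff.1 h0
    exact hker z (Subsingleton.elim _ _)
  · right
    obtain ⟨e⟩ := Module.nonempty_linearEquiv_of_finrank_eq_one h1
    refine ⟨e.symm.toLinearMap.comp π, e.symm.surjective.comp hπ, fun z hz => ?_, fun z hz => ?_⟩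
    · have : L.mkQ z = 0 := (Submodule.Quotient.mk_eq_zero _).2 hz
      simp [π, this]
    · exact hker z (by simpa using hz)

/-- If the points span a space of dimension at least three, then `c` is a quotient of two
multiples of `(a₁, a₂)` which are small modulo `p`. -/
theorem exists_dual_of_three_le_finrank {p : ℕ} [Fact p.Prime] {a₁ a₂ c : ZMod p} {H₁ H₂ : ℕ}
    (ha₁ : a₁ ≠ 0) (ha₂ : a₂ ≠ 0) (hc : c ≠ 0) (hH₁ : 0 < H₁) (hH₂ : 0 < H₂)
    (hK : 13 ^ 4 * (H₁ * H₂) ^ 2 < (ratioPoints a₁ a₂ c H₁ H₂).card * p)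
    (hr : 3 ≤ Module.finrank ℤ
      (Submodule.span ℤ (ratioPoints a₁ a₂ c H₁ H₂ : Set (Fin 4 → ℤ)))) :
    ∃ n : Fin 4 → ℤ,
      (∀ i, (n i : ZMod p) ≠ 0) ∧ a₁ * (n 1 : ℤ) = a₂ * (n 0 : ℤ) ∧
      a₁ * (n 3 : ℤ) = a₂ * (n 2 : ℤ) ∧ c * (n 0 : ℤ) = -(n 2 : ℤ) ∧
      ∀ i, (ratioPoints a₁ a₂ c H₁ H₂).card * (|n i| * (![H₁, H₂, H₁, H₂] i : ℕ))
        ≤ 13 ^ 4 * (H₁ * H₂) ^ 2 := by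
  set S := ratioPoints a₁ a₂ c H₁ H₂ with hS
  have hzero := fun {z N} => ratioForm_eq_zero_of_smul_mem_span (z := z) (N := N) hH₁ hH₂ hK
  obtain h | ⟨f, hsurj, hfL, hker⟩ := exists_functional_of_three_le_finrank _ hr
  · obtain ⟨N, hN, hNz⟩ := h (Pi.single 0 1)
    have := hzero hN hNz
    simp [ratioForm_apply, ha₁] at this
  obtain ⟨e, he⟩ := hsurj 1
  have hform : ∀ z, ratioForm a₁ a₂ c z = f z * ratioForm a₁ a₂ c e := by
    intro z
    obtain ⟨N, hN, hNz⟩ := hker (z - f z • e) (by rw [map_sub, map_smul, he]; simp)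
    have := hzero hN hNz
    rw [map_sub, map_zsmul, zsmul_eq_mul, sub_eq_zero] at this
    exact this
  set τ := ratioForm a₁ a₂ c e
  have h0 := hform (Pi.single 0 1)
  have h1 := hform (Pi.single 1 1)
  have h2 := hform (Pi.single 2 1)
  have h3 := hform (Pi.single 3 1)
  simp only [ratioForm_apply] at h0 h1 h2 h3
  simp at h0 h1 h2 h3
  have hτ : τ ≠ 0 := by rintro h; rw [h] at h0; simp [ha₁] at h0
  refine ⟨fun i => f (Pi.single i 1), fun i => ?_, ?_, ?_, ?_, fun i => ?_⟩
  · intro h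
    fin_cases i
    · exact ha₁ (by rw [h0]; simpa using Or.inl h)
    · exact ha₂ (by rw [h1]; simpa using Or.inl h)
    · exact neg_ne_zero.2 (mul_ne_zero hc ha₁) (by rw [h2]; simpa using Or.inl h)
    · exact neg_ne_zero.2 (mul_ne_zero hc ha₂) (by rw [h3]; simpa using Or.inl h)
  · refine mul_right_cancel₀ hτ ?_
    linear_combination a₂ * h0 - a₁ * h1
  · refine mul_right_cancel₀ hτ ?_
    linear_combination a₂ * h2 - a₁ * h3
  · refine mul_right_cancel₀ hτ ?_
    linear_combination -c * h0 - h2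
  · set h : Fin 4 → ℕ := ![H₁, H₂, H₁, H₂] with hh
    set m := f (Pi.single i 1) with hm
    set B : ℕ := m.natAbs * h i with hB
    by_cases hm0 : m = 0
    · have : |(fun i => f (Pi.single i 1)) i| = 0 := by rw [abs_eq_zero]; exact hm0
      rw [this, zero_mul, mul_zero]; positivity
    have hfj : ∀ j : ℕ, f ((j : ℤ) • e) = j := fun j => by
      rw [map_smul, he]; simp
    have hinj : Set.InjOn (fun j : ℕ => (j : ℤ) • e) (Finset.range B) := by
      intro i _ j _ hij
      have := congrArg f hij
      dsimp only at this
      rw [hfj, hfj] at this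
      exact_mod_cast this
    have key := card_mul_card_le_of_smul_sub_mem_span S
      ((Finset.range B).image fun j : ℕ => (j : ℤ) • e) h (ratioPoints_subset hH₁ hH₂)
      (sides_pos hH₁ hH₂) f.toAddMonoidHom
      (fun x hx => hfL x (Submodule.subset_span hx)) ?_ ?_
    · rw [Finset.card_image_of_injOn hinj, Finset.card_range, hh, prod_sides,
        Fintype.card_fin] at key
      have h5 : (B : ℤ) = |m| * (h i : ℕ) := by rw [hB]; push_cast; rfl
      rw [← h5]
      exact_mod_cast key
    · rw [Finset.coe_image]
      rintro _ ⟨i, hi, rfl⟩ _ ⟨j, hj, rfl⟩ hij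
      have : f ((i : ℤ) • e) = f ((j : ℤ) • e) := hij
      rw [hfj, hfj] at this
      have : i = j := by exact_mod_cast this
      rw [this]
    · intro y hy
      obtain ⟨j, hj, rfl⟩ := Finset.mem_image.1 hy
      obtain ⟨N, hN, hNz⟩ := hker (m • ((j : ℤ) • e) - (j : ℤ) • Pi.single i 1) (by
        rw [map_sub, map_smul, hfj, map_smul, ← hm]; simp [mul_comm])
      refine ⟨N * m, mul_ne_zero hN hm0, N • ((j : ℤ) • Pi.single i 1), ?_, fun l => ?_⟩
      · rw [smul_sub, smul_smul] at hNz; exact hNz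
      · rw [Pi.smul_apply, Pi.smul_apply, smul_eq_mul, smul_eq_mul, abs_mul, abs_mul, abs_mul,
          mul_assoc |N|]
        refine mul_le_mul_of_nonneg_left ?_ (abs_nonneg _)
        by_cases hl : l = i
        · subst hl
          have : j < B := Finset.mem_range.1 hj
          have h5 : (B : ℤ) = |m| * (h l : ℕ) := by rw [hB]; push_cast; rfl
          simp only [Pi.single_eq_same, abs_one, Nat.abs_cast]
          rw [← h5, mul_one]
          exact_mod_cast this.le
        · simp [Pi.single_eq_of_ne hl]; positivity

/-- Pigeonhole modulo `m` in the lattice spanned by a finite set. -/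
theorem exists_sub_eq_smul_of_pow_finrank_lt_card {ι : Type*} [Fintype ι] (S : Finset (ι → ℤ))
    {m : ℕ} (hm : 0 < m)
    (h : m ^ Module.finrank ℤ (Submodule.span ℤ (S : Set (ι → ℤ))) < S.card) :
    ∃ x ∈ S, ∃ x' ∈ S, ∃ y ∈ Submodule.span ℤ (S : Set (ι → ℤ)), y ≠ 0 ∧
      x - x' = (m : ℤ) • y := by
  classical
  have : NeZero m := ⟨hm.ne'⟩
  set L := Submodule.span ℤ (S : Set (ι → ℤ)) with hL
  let b := Module.finBasis ℤ L
  let g : S → (Fin (Module.finrank ℤ L) → ZMod m) := fun x i =>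
    ((b.repr ⟨x, Submodule.subset_span x.2⟩ i : ℤ) : ZMod m)
  obtain ⟨x, x', hne, hg⟩ := Fintype.exists_ne_map_eq_of_card_lt g (by
    simpa [ZMod.card] using h)
  have hdvd : ∀ i, (m : ℤ) ∣ b.repr (⟨x, Submodule.subset_span x.2⟩ - ⟨x', Submodule.subset_span x'.2⟩) i := by
    intro i
    have := congrFun hg i
    rw [← ZMod.intCast_zmod_eq_zero_iff_dvd]
    rw [map_sub, Finsupp.sub_apply, Int.cast_sub, sub_eq_zero]
    exact this
  choose c hc using hdvd
  have hsum : (⟨x, Submodule.subset_span x.2⟩ - ⟨x', Submodule.subset_span x'.2⟩ : L)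
      = (m : ℤ) • ∑ i, c i • b i := by
    rw [← b.sum_repr (⟨x, Submodule.subset_span x.2⟩ - ⟨x', Submodule.subset_span x'.2⟩ : L),
      Finset.smul_sum]
    exact Finset.sum_congr rfl fun i _ => by rw [hc i, mul_smul]
  have heq : (x : ι → ℤ) - x' = (m : ℤ) • ((∑ i, c i • b i : L) : ι → ℤ) := congrArg Subtype.val hsum
  refine ⟨x, x.2, x', x'.2, _, (∑ i, c i • b i : L).2, fun h0 => hne ?_, heq⟩
  rw [h0, smul_zero, sub_eq_zero] at heq
  exact Subtype.ext heq

theorem exists_dependence_of_finrank_le_two {ι : Type*} [Fintype ι] {L : Submodule ℤ (ι → ℤ)}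
    (hL : Module.finrank ℤ L ≤ 2) {u v w : ι → ℤ} (hu : u ∈ L) (hv : v ∈ L) (hw : w ∈ L) :
    ∃ α β γ : ℤ, (α ≠ 0 ∨ β ≠ 0 ∨ γ ≠ 0) ∧ α • u + β • v + γ • w = 0 := by
  have h : ¬ LinearIndependent ℤ (![⟨u, hu⟩, ⟨v, hv⟩, ⟨w, hw⟩] : Fin 3 → L) := by
    intro h
    have := h.fintype_card_le_finrank
    simp only [Fintype.card_fin] at this
    lia
  obtain ⟨g, hg, i, hi⟩ := Fintype.not_linearIndependent_iff.1 h
  refine ⟨g 0, g 1, g 2, ?_, ?_⟩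
  · fin_cases i
    · exact Or.inl hi
    · exact Or.inr (Or.inl hi)
    · exact Or.inr (Or.inr hi)
  · have := congrArg Subtype.val hg
    simpa [Fin.sum_univ_three] using this

theorem ratioForm_eq_zero_of_mem_span {p : ℕ} {a₁ a₂ c : ZMod p} {H₁ H₂ : ℕ}
    {z : Fin 4 → ℤ}
    (hz : z ∈ Submodule.span ℤ (ratioPoints a₁ a₂ c H₁ H₂ : Set (Fin 4 → ℤ))) :
    ratioForm a₁ a₂ c z = 0 := by
  refine Submodule.span_induction (p := fun x _ => ratioForm a₁ a₂ c x = 0) ?_ (map_zero _) ?_ ?_ hz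
  · exact fun x hx => (Finset.mem_filter.1 (Finset.mem_coe.1 hx)).2
  · intro x y _ _ hx hy; rw [map_add, hx, hy, add_zero]
  · intro a x _ hx; rw [map_zsmul, hx, smul_zero]

/-- If the points span a space of dimension at most two, then there is a short nonzero point. -/
theorem exists_short_of_finrank_le_two {p : ℕ} {a₁ a₂ c : ZMod p} {H₁ H₂ : ℕ}
    (hH₁ : 0 < H₁) (hH₂ : 0 < H₂)
    (hr : Module.finrank ℤ
      (Submodule.span ℤ (ratioPoints a₁ a₂ c H₁ H₂ : Set (Fin 4 → ℤ))) ≤ 2)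
    {m : ℕ} (hm : 0 < m) (hK : m ^ 2 < (ratioPoints a₁ a₂ c H₁ H₂).card) :
    ∃ y ∈ ratioPoints a₁ a₂ c H₁ H₂, y ≠ 0 ∧
      ∀ i, m * |y i| < 2 * (![H₁, H₂, H₁, H₂] i : ℕ) := by
  set S := ratioPoints a₁ a₂ c H₁ H₂ with hS
  have hmem := fun {z} => mem_ratioPoints (a₁ := a₁) (a₂ := a₂) (c := c) (z := z) hH₁ hH₂
  rcases (by lia : m = 1 ∨ 2 ≤ m) with rfl | hm2
  · obtain ⟨y, hy, hy0⟩ := Finset.exists_mem_ne (s := S) (by lia) 0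
    refine ⟨y, hy, hy0, fun i => ?_⟩
    have := (hmem.1 hy).1 i
    have := abs_nonneg (y i)
    push_cast
    linarith
  · obtain ⟨x, hx, x', hx', y, hyL, hy0, hxy⟩ :=
      exists_sub_eq_smul_of_pow_finrank_lt_card S hm
        ((Nat.pow_le_pow_right hm hr).trans_lt hK)
    have hlt : ∀ i, m * |y i| < 2 * (![H₁, H₂, H₁, H₂] i : ℕ) := by
      intro i
      have h1 := (hmem.1 hx).1 i
      have h2 := (hmem.1 hx').1 i
      have h3 := congrArg abs (congrFun hxy i)
      rw [Pi.smul_apply, smul_eq_mul, abs_mul, Nat.abs_cast] at h3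
      rw [← h3]
      exact (abs_sub _ _).trans_lt (by linarith)
    refine ⟨y, hmem.2 ⟨fun i => ?_, ratioForm_eq_zero_of_mem_span hyL⟩, hy0, hlt⟩
    have h1 := hlt i
    have h2 := abs_nonneg (y i)
    have h3 : (2 : ℤ) ≤ m := by exact_mod_cast hm2
    nlinarith

/-- On a set of pairwise proportional vectors of the plane, one of the two coordinates determines
the other. -/
theorem exists_coordinate_determines {α : Type*} (S : Set α) (g k : α → ℤ)
    (h : ∀ u ∈ S, ∀ v ∈ S, g u * k v = k u * g v) :
    (∀ u ∈ S, ∀ v ∈ S, g u = g v → k u = k v) ∨ (∀ u ∈ S, ∀ v ∈ S, k u = k v → g u = g v) := by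
  by_cases h0 : ∀ u ∈ S, g u = 0
  · exact Or.inr fun u hu v hv _ => by rw [h0 u hu, h0 v hv]
  · push Not at h0
    obtain ⟨w, hw, hw0⟩ := h0
    refine Or.inl fun u hu v hv huv => mul_left_cancel₀ hw0 ?_
    rw [h w hw u hu, h w hw v hv, huv]

theorem exists_ne_mul_abs_sub_lt {α : Type*} (F : Finset α) (g : α → ℤ) {q H : ℕ} (hq : 0 < q)
    (hH : 0 < H) (hF : q < F.card) (hg : ∀ n ∈ F, |g n| < H) :
    ∃ n ∈ F, ∃ n' ∈ F, n ≠ n' ∧ q * |g n - g n'| < 2 * H := by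
  by_contra! hcon
  have hq' : (0 : ℤ) < q := by exact_mod_cast hq
  have hH' : (0 : ℤ) < H := by exact_mod_cast hH
  have := card_mul_le_of_separated F (fun n => q * g n) (q * (H - 1)) (B := 2 * H)
    (by positivity) (mul_nonneg hq'.le (by lia))
    (fun n hn => by
      rw [abs_mul, Nat.abs_cast]
      have := hg n hn
      exact mul_le_mul_of_nonneg_left (by lia) hq'.le)
    (fun n hn n' hn' hne => by
      rw [← mul_sub, abs_mul, Nat.abs_cast]
      exact hcon n hn n' hn' hne)
  have h1 : (q : ℤ) + 1 ≤ F.card := by exact_mod_cast hF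
  nlinarith

/-- If moreover there is a nonzero point whose coordinates of index `1` and `3` vanish, then there
is a very short such point. -/
theorem exists_short_of_finrank_le_two_of_degenerate {p : ℕ} [Fact p.Prime] {a₁ a₂ c : ZMod p}
    {H₁ H₂ : ℕ} (ha₁ : a₁ ≠ 0) (hH₁ : 0 < H₁) (hH₂ : 0 < H₂)
    (hK : 13 ^ 4 * (H₁ * H₂) ^ 2 < (ratioPoints a₁ a₂ c H₁ H₂).card * p)
    (hr : Module.finrank ℤ
      (Submodule.span ℤ (ratioPoints a₁ a₂ c H₁ H₂ : Set (Fin 4 → ℤ))) ≤ 2)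
    {y : Fin 4 → ℤ} (hy : y ∈ ratioPoints a₁ a₂ c H₁ H₂) (hy0 : y ≠ 0) (hy1 : y 1 = 0)
    (hy3 : y 3 = 0) {q : ℕ} (hq2 : 2 ≤ q)
    (hq : 2 * H₂ * q < (ratioPoints a₁ a₂ c H₁ H₂).card) :
    ∃ y ∈ ratioPoints a₁ a₂ c H₁ H₂, y ≠ 0 ∧ y 1 = 0 ∧ y 3 = 0 ∧
      q * |y 0| < 2 * H₁ ∧ q * |y 2| < 2 * H₁ := by
  set S := ratioPoints a₁ a₂ c H₁ H₂ with hS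
  set L := Submodule.span ℤ (S : Set (Fin 4 → ℤ)) with hL
  have hmem := fun {z} => mem_ratioPoints (a₁ := a₁) (a₂ := a₂) (c := c) (z := z) hH₁ hH₂
  have hyL : y ∈ L := Submodule.subset_span hy
  have hy02 : y 0 ≠ 0 ∨ y 2 ≠ 0 := by
    by_contra! h
    refine hy0 (funext fun i => ?_)
    fin_cases i
    exacts [h.1, hy1, h.2, hy3]
  -- vectors of the lattice in the degenerate plane are proportional to each other
  have hplane : ∀ u ∈ L, ∀ v ∈ L, u 1 = 0 → u 3 = 0 → v 1 = 0 → v 3 = 0 →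
      u 0 * v 2 = u 2 * v 0 := by
    intro u hu v hv hu1 hu3 hv1 hv3
    by_contra hne
    have h1 : (u 0 * v 2 - u 2 * v 0) • (Pi.single 0 1 : Fin 4 → ℤ) ∈ L := by
      have : (u 0 * v 2 - u 2 * v 0) • (Pi.single 0 1 : Fin 4 → ℤ) = v 2 • u - u 2 • v := by
        ext i
        fin_cases i <;> simp [hu1, hu3, hv1, hv3] <;> ring
      rw [this]
      exact sub_mem (Submodule.smul_mem _ _ hu) (Submodule.smul_mem _ _ hv)
    have := ratioForm_eq_zero_of_smul_mem_span hH₁ hH₂ hK (sub_ne_zero.2 hne) h1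
    simp [ratioForm_apply, ha₁] at this
  have hproj : ∀ u ∈ (S : Set (Fin 4 → ℤ)), ∀ v ∈ (S : Set (Fin 4 → ℤ)),
      u 1 * v 3 = u 3 * v 1 := by
    intro u hu v hv
    obtain ⟨α, β, γ, hne, h⟩ := exists_dependence_of_finrank_le_two hr hyL
      (Submodule.subset_span hu) (Submodule.subset_span hv)
    have e := fun i => congrFun h i
    simp only [Pi.add_apply, Pi.smul_apply, smul_eq_mul, Pi.zero_apply] at e
    have e1 := e 1
    have e3 := e 3
    rw [hy1, mul_zero, zero_add] at e1
    rw [hy3, mul_zero, zero_add] at e3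
    by_cases hβ : β = 0
    · by_cases hγ : γ = 0
      · subst hβ hγ
        have hα : α ≠ 0 := by simpa using hne
        have e0 := e 0
        have e2 := e 2
        simp only [zero_mul, add_zero, mul_eq_zero, hα, false_or] at e0 e2
        rcases hy02 with h | h
        · exact absurd e0 h
        · exact absurd e2 h
      · refine mul_left_cancel₀ hγ ?_
        linear_combination u 1 * e3 - u 3 * e1
    · refine mul_left_cancel₀ hβ ?_
      linear_combination v 3 * e1 - v 1 * e3
  obtain ⟨j, hj, hdet⟩ : ∃ j : Fin 4, (![H₁, H₂, H₁, H₂] j : ℕ) = H₂ ∧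
      ∀ u ∈ S, ∀ v ∈ S, u j = v j → u 1 = v 1 ∧ u 3 = v 3 := by
    rcases exists_coordinate_determines (S : Set (Fin 4 → ℤ)) (fun u => u 1) (fun u => u 3) hproj
      with h | h
    · exact ⟨1, rfl, fun u hu v hv huv => ⟨huv, h u hu v hv huv⟩⟩
    · exact ⟨3, rfl, fun u hu v hv huv => ⟨h u hu v hv huv, huv⟩⟩
  obtain ⟨i, i', hi, hi', hi0, hdom⟩ : ∃ i i' : Fin 4, (![H₁, H₂, H₁, H₂] i : ℕ) = H₁ ∧
      (![H₁, H₂, H₁, H₂] i' : ℕ) = H₁ ∧ ({i, i'} : Set (Fin 4)) = {0, 2} ∧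
      ∀ d ∈ L, d 1 = 0 → d 3 = 0 → |d i'| ≤ |d i| := by
    rcases le_total |y 2| |y 0| with h | h
    · refine ⟨0, 2, rfl, rfl, rfl, fun d hd hd1 hd3 => ?_⟩
      have hne : y 0 ≠ 0 := by
        rintro h0
        rw [h0, abs_zero] at h
        have := abs_nonpos_iff.1 h
        tauto
      have := dominated_of_proportional (H₁ := 1) (H₂ := 1) hne (by simpa using h)
        (hplane y hyL d hd hy1 hy3 hd1 hd3)
      simpa using this
    · refine ⟨2, 0, rfl, rfl, Set.pair_comm _ _, fun d hd hd1 hd3 => ?_⟩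
      have hne : y 2 ≠ 0 := by
        rintro h0
        rw [h0, abs_zero] at h
        have := abs_nonpos_iff.1 h
        tauto
      have := dominated_of_proportional (H₁ := 1) (H₂ := 1) hne (by simpa using h)
        (hplane y hyL d hd hy1 hy3 hd1 hd3).symm
      simpa using this
  obtain ⟨t, -, ht⟩ := Finset.exists_lt_card_fiber_of_mul_lt_card_of_maps_to (s := S)
    (t := Finset.Icc (-(H₂ - 1 : ℤ)) (H₂ - 1)) (f := fun z => z j) (n := q)
    (fun z hz => by
      have := (hmem.1 hz).1 j
      rw [hj, abs_lt] at this
      rw [Finset.mem_Icc]; lia)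
    (by
      rw [Int.card_Icc]
      refine lt_of_le_of_lt (Nat.mul_le_mul_right _ ?_) hq
      lia)
  obtain ⟨z, hz, z', hz', hne, hlt⟩ := exists_ne_mul_abs_sub_lt _ (fun z : Fin 4 → ℤ => z i)
    (by lia) hH₁ ht (fun z hz => by
      have := (hmem.1 (Finset.mem_filter.1 hz).1).1 i
      rwa [hi] at this)
  obtain ⟨hzS, hzt⟩ := Finset.mem_filter.1 hz
  obtain ⟨hzS', hzt'⟩ := Finset.mem_filter.1 hz'
  obtain ⟨h1, h3⟩ := hdet z hzS z' hzS' (hzt.trans hzt'.symm)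
  have hdL : z - z' ∈ L := sub_mem (Submodule.subset_span hzS) (Submodule.subset_span hzS')
  have hd1 : (z - z') 1 = 0 := sub_eq_zero.2 h1
  have hd3 : (z - z') 3 = 0 := sub_eq_zero.2 h3
  have hlt' : q * |(z - z') i'| < 2 * H₁ :=
    (mul_le_mul_of_nonneg_left (hdom _ hdL hd1 hd3) (by positivity)).trans_lt hlt
  have hboth : q * |(z - z') 0| < 2 * (H₁ : ℤ) ∧ q * |(z - z') 2| < 2 * (H₁ : ℤ) := by
    have h0 : (0 : Fin 4) ∈ ({i, i'} : Set (Fin 4)) := by rw [hi0]; simp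
    have h2 : (2 : Fin 4) ∈ ({i, i'} : Set (Fin 4)) := by rw [hi0]; simp
    constructor
    · rcases h0 with h | h
      · rw [h]; exact hlt
      · rw [Set.mem_singleton_iff.1 h]; exact hlt'
    · rcases h2 with h | h
      · rw [h]; exact hlt
      · rw [Set.mem_singleton_iff.1 h]; exact hlt'
  have hq2' : (2 : ℤ) ≤ q := by exact_mod_cast hq2
  have hsmall : ∀ x : ℤ, q * |x| < 2 * H₁ → |x| < H₁ := by
    intro x hx
    have := abs_nonneg x
    nlinarith
  refine ⟨z - z', hmem.2 ⟨fun l => ?_, ratioForm_eq_zero_of_mem_span hdL⟩, sub_ne_zero.2 hne,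
    hd1, hd3, hboth.1, hboth.2⟩
  fin_cases l
  · exact hsmall _ hboth.1
  · show |(z - z') 1| < (H₂ : ℤ)
    rw [hd1, abs_zero]; exact_mod_cast hH₂
  · exact hsmall _ hboth.2
  · show |(z - z') 3| < (H₂ : ℤ)
    rw [hd3, abs_zero]; exact_mod_cast hH₂

theorem eq_div_of_mem_ratioPoints {p : ℕ} [Fact p.Prime] {a₁ a₂ c : ZMod p} {H₁ H₂ : ℕ}
    (hH₁ : 0 < H₁) (hH₂ : 0 < H₂) (hP : IsProperBox a₁ a₂ H₁ H₂) {y : Fin 4 → ℤ}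
    (hy : y ∈ ratioPoints a₁ a₂ c H₁ H₂) (hy0 : y ≠ 0) :
    c = (a₁ * (y 0 : ℤ) + a₂ * (y 1 : ℤ)) / (a₁ * (y 2 : ℤ) + a₂ * (y 3 : ℤ)) := by
  obtain ⟨hb, hf⟩ := (mem_ratioPoints hH₁ hH₂).1 hy
  rw [ratioForm_apply] at hf
  have hne : a₁ * (y 2 : ℤ) + a₂ * (y 3 : ℤ) ≠ 0 := by
    intro h
    rw [h, mul_zero, sub_zero] at hf
    obtain ⟨h2, h3⟩ := hP _ _ (hb 2) (hb 3) h
    obtain ⟨h0, h1⟩ := hP _ _ (hb 0) (hb 1) hf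
    refine hy0 (funext fun i => ?_)
    fin_cases i
    exacts [h0, h1, h2, h3]
  rw [eq_div_iff hne]
  linear_combination -hf

theorem two_mul_div_add_one_mul_le {a m : ℕ} (h : m ≤ 2 * a) :
    (2 * (2 * a / m) + 1) * m ≤ 6 * a := by
  have := Nat.div_mul_le_self (2 * a) m
  nlinarith

/-- The set of nonzero `c` for which `ratioForm` has at least `k` zeros in the box. -/
noncomputable def richRatios {p : ℕ} [Fact p.Prime] (a₁ a₂ : ZMod p) (H₁ H₂ k : ℕ) :
    Finset (ZMod p) :=
  {c : ZMod p | c ≠ 0 ∧ k ≤ (ratioPoints a₁ a₂ c H₁ H₂).card}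

theorem le_div_of_mul_abs_le {a m : ℕ} {x : ℤ} (hm : 0 < m) (h : m * |x| ≤ a) :
    |x| ≤ ((a / m : ℕ) : ℤ) := by
  push_cast
  exact (Int.le_ediv_iff_mul_le (by exact_mod_cast hm)).2 (by linarith)

/-- Multiples of `(a₁, a₂)` modulo `p`, nonzero in each coordinate, in a dual box. -/
noncomputable def dualPoints {p : ℕ} (a₁ a₂ : ZMod p) (H₁ H₂ R : ℕ) : Finset (Fin 2 → ℤ) :=
  (intBox ![R / H₁, R / H₂]).filter fun n =>
    (n 0 ≠ 0 ∧ n 1 ≠ 0) ∧ a₁ * (n 1 : ℤ) = a₂ * (n 0 : ℤ)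

theorem card_dualPoints_mul_le {p : ℕ} [Fact p.Prime] {a₁ a₂ : ZMod p} (ha₂ : a₂ ≠ 0) {H₁ H₂ : ℕ}
    (hH₁ : 0 < H₁) (hH₂ : 0 < H₂) (hP : IsProperBox a₁ a₂ H₁ H₂) {R : ℕ} (hR : R ≤ p) :
    (dualPoints a₁ a₂ H₁ H₂ R).card * (H₁ * H₂) ≤ 81 * R := by
  have hmul : ∀ {H : ℕ} {x : ℤ}, |x| ≤ ((R / H : ℕ) : ℤ) → |x| * H ≤ R := by
    intro H x hx
    have h1 : ((R / H * H : ℕ) : ℤ) ≤ R := by exact_mod_cast Nat.div_mul_le_self R H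
    push_cast at h1 hx
    nlinarith
  refine card_dual_mul_le ha₂ hH₁ hH₂ hP hR _ (fun n hn => ?_) (fun n hn => ?_) (fun n hn => ?_)
    (fun n hn => ?_)
  · exact (Finset.mem_filter.1 hn).2.1
  · exact hmul (mem_intBox.1 (Finset.mem_filter.1 hn).1 0)
  · exact hmul (mem_intBox.1 (Finset.mem_filter.1 hn).1 1)
  · exact (Finset.mem_filter.1 hn).2.2

theorem mem_image_dualPoints {p : ℕ} [Fact p.Prime] {a₁ a₂ c : ZMod p} (ha₁ : a₁ ≠ 0)
    (ha₂ : a₂ ≠ 0) (hc : c ≠ 0) {H₁ H₂ k : ℕ} (hH₁ : 0 < H₁) (hH₂ : 0 < H₂) (hk : 0 < k)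
    (hkK : k ≤ (ratioPoints a₁ a₂ c H₁ H₂).card)
    (hK : 13 ^ 4 * (H₁ * H₂) ^ 2 < (ratioPoints a₁ a₂ c H₁ H₂).card * p)
    (hr : 3 ≤ Module.finrank ℤ
      (Submodule.span ℤ (ratioPoints a₁ a₂ c H₁ H₂ : Set (Fin 4 → ℤ)))) :
    c ∈ (dualPoints a₁ a₂ H₁ H₂ (13 ^ 4 * (H₁ * H₂) ^ 2 / k) ×ˢ
      dualPoints a₁ a₂ H₁ H₂ (13 ^ 4 * (H₁ * H₂) ^ 2 / k)).image
        fun q => -(q.2 0 : ZMod p) / (q.1 0 : ZMod p) := by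
  obtain ⟨n, hn0, h01, h23, hcn, hb⟩ := exists_dual_of_three_le_finrank ha₁ ha₂ hc hH₁ hH₂ hK hr
  have hne : ∀ i, n i ≠ 0 := fun i h => hn0 i (by rw [h, Int.cast_zero])
  have hle : ∀ {i : Fin 4} {H : ℕ}, 0 < H → (![H₁, H₂, H₁, H₂] i : ℕ) = H →
      |n i| ≤ ((13 ^ 4 * (H₁ * H₂) ^ 2 / k / H : ℕ) : ℤ) := by
    intro i H hH hi
    rw [Nat.div_div_eq_div_mul]
    refine le_div_of_mul_abs_le (Nat.mul_pos hk hH) ?_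
    have h1 := hb i
    rw [hi] at h1
    have h2 : (k : ℤ) * (|n i| * H) ≤ (ratioPoints a₁ a₂ c H₁ H₂).card * (|n i| * H) :=
      mul_le_mul_of_nonneg_right (by exact_mod_cast hkK) (by positivity)
    push_cast
    linarith
  refine Finset.mem_image.2 ⟨(![n 0, n 1], ![n 2, n 3]), Finset.mem_product.2 ⟨?_, ?_⟩, ?_⟩
  · refine Finset.mem_filter.2 ⟨mem_intBox.2 fun i => ?_, ⟨hne 0, hne 1⟩, h01⟩
    fin_cases i
    · exact hle hH₁ rfl
    · exact hle hH₂ rfl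
  · refine Finset.mem_filter.2 ⟨mem_intBox.2 fun i => ?_, ⟨hne 2, hne 3⟩, h23⟩
    fin_cases i
    · exact hle hH₁ rfl
    · exact hle hH₂ rfl
  · simp only [Matrix.cons_val_zero]
    rw [div_eq_iff (hn0 0), hcn]

/-- The constant in the bound for the number of rich ratios. -/
def richConst : ℕ := 2 ^ 4 * 6 ^ 4 + 81 ^ 2 * 13 ^ 8

theorem eq_zero_of_mul_abs_lt {m a x : ℤ} (h : m * |x| < a) (ha : 0 ≤ a) (ham : a ≤ m) :
    x = 0 := by
  by_contra hne
  have h1 := Int.one_le_abs hne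
  have h2 : m * 1 ≤ m * |x| := mul_le_mul_of_nonneg_left h1 (ha.trans ham)
  lia

theorem sq_mul_card_richRatios_le {p : ℕ} [Fact p.Prime] {a₁ a₂ : ZMod p} (ha₁ : a₁ ≠ 0)
    (ha₂ : a₂ ≠ 0) {H₁ H₂ : ℕ} (hH₁ : 0 < H₁) (hH₂ : 0 < H₂) (hH : H₂ ≤ H₁)
    (hP : IsProperBox a₁ a₂ H₁ H₂) {k : ℕ} (hk : 2 ≤ k) (hkp : 13 ^ 4 * (H₁ * H₂) ^ 2 < k * p) :
    k ^ 2 * (richRatios a₁ a₂ H₁ H₂ k).card ≤ richConst * (H₁ * H₂) ^ 2 := by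
  set R := 13 ^ 4 * (H₁ * H₂) ^ 2 / k with hR
  set T := dualPoints a₁ a₂ H₁ H₂ R with hT
  set m := Nat.sqrt (k - 1) with hm
  have hm1 : 0 < m := Nat.sqrt_pos.2 (by lia)
  have hmk : m ^ 2 < k := by have := Nat.sqrt_le' (k - 1); rw [← hm] at this; lia
  have hkm : k ≤ (m + 1) ^ 2 := by have := Nat.lt_succ_sqrt' (k - 1); rw [← hm] at this; lia
  have hk4 : k ^ 2 ≤ 2 ^ 4 * m ^ 4 := by
    have : k ≤ 4 * m ^ 2 := hkm.trans (by nlinarith)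
    calc k ^ 2 ≤ (4 * m ^ 2) ^ 2 := Nat.pow_le_pow_left this 2
      _ = _ := by ring
  set gC : Finset (ZMod p) := (T ×ˢ T).image fun q => -(q.2 0 : ZMod p) / (q.1 0 : ZMod p)
  have hgC : k ^ 2 * gC.card ≤ 81 ^ 2 * 13 ^ 8 * (H₁ * H₂) ^ 2 := by
    have hRp : R ≤ p := by
      have : R * k ≤ 13 ^ 4 * (H₁ * H₂) ^ 2 := Nat.div_mul_le_self _ _
      exact (Nat.lt_of_mul_lt_mul_right (this.trans_lt (by linarith : _ < p * k))).le
    have h1 := card_dualPoints_mul_le ha₂ hH₁ hH₂ hP hRp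
    have h2 : gC.card ≤ T.card ^ 2 := Finset.card_image_le.trans (by
      rw [Finset.card_product, sq])
    have h3 : (k * T.card) * (H₁ * H₂) ≤ (81 * 13 ^ 4 * (H₁ * H₂)) * (H₁ * H₂) := by
      calc (k * T.card) * (H₁ * H₂) = (T.card * (H₁ * H₂)) * k := by ring
        _ ≤ 81 * R * k := Nat.mul_le_mul_right _ h1
        _ = 81 * (R * k) := by ring
        _ ≤ 81 * (13 ^ 4 * (H₁ * H₂) ^ 2) := Nat.mul_le_mul_left _ (Nat.div_mul_le_self _ _)
        _ = _ := by ring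
    have h4 := Nat.le_of_mul_le_mul_right h3 (Nat.mul_pos hH₁ hH₂)
    calc k ^ 2 * gC.card ≤ k ^ 2 * T.card ^ 2 := Nat.mul_le_mul_left _ h2
      _ = (k * T.card) ^ 2 := by ring
      _ ≤ (81 * 13 ^ 4 * (H₁ * H₂)) ^ 2 := Nat.pow_le_pow_left h4 2
      _ = _ := by ring
  have hKp : ∀ c, k ≤ (ratioPoints a₁ a₂ c H₁ H₂).card →
      13 ^ 4 * (H₁ * H₂) ^ 2 < (ratioPoints a₁ a₂ c H₁ H₂).card * p := fun c hc =>
    hkp.trans_le (Nat.mul_le_mul_right _ hc)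
  have hsmall : ∀ c, k ≤ (ratioPoints a₁ a₂ c H₁ H₂).card → m ^ 2 <
      (ratioPoints a₁ a₂ c H₁ H₂).card := fun c hc => hmk.trans_le hc
  suffices h : ∃ g : Finset (ZMod p), k ^ 2 * g.card ≤ 2 ^ 4 * 6 ^ 4 * (H₁ * H₂) ^ 2 ∧
      ∀ c, k ≤ (ratioPoints a₁ a₂ c H₁ H₂).card → Module.finrank ℤ
        (Submodule.span ℤ (ratioPoints a₁ a₂ c H₁ H₂ : Set (Fin 4 → ℤ))) ≤ 2 → c ∈ g by
    obtain ⟨g, hg, hcg⟩ := h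
    have hsub : richRatios a₁ a₂ H₁ H₂ k ⊆ g ∪ gC := by
      intro c hc
      obtain ⟨-, hc0, hck⟩ := Finset.mem_filter.1 hc
      rcases Nat.lt_or_ge 2 (Module.finrank ℤ
        (Submodule.span ℤ (ratioPoints a₁ a₂ c H₁ H₂ : Set (Fin 4 → ℤ)))) with hr | hr
      · exact Finset.mem_union_right _
          (mem_image_dualPoints ha₁ ha₂ hc0 hH₁ hH₂ (by lia) hck (hKp c hck) hr)
      · exact Finset.mem_union_left _ (hcg c hck hr)
    have := (Finset.card_le_card hsub).trans (Finset.card_union_le _ _)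
    rw [richConst]
    calc k ^ 2 * (richRatios a₁ a₂ H₁ H₂ k).card ≤ k ^ 2 * (g.card + gC.card) :=
          Nat.mul_le_mul_left _ this
      _ = k ^ 2 * g.card + k ^ 2 * gC.card := by ring
      _ ≤ _ := by linarith
  rcases Nat.lt_or_ge m (2 * H₂) with hmH | hmH
  · refine ⟨(intBox ![2 * H₁ / m, 2 * H₂ / m, 2 * H₁ / m, 2 * H₂ / m]).image fun y =>
      (a₁ * (y 0 : ℤ) + a₂ * (y 1 : ℤ)) / (a₁ * (y 2 : ℤ) + a₂ * (y 3 : ℤ)), ?_,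
      fun c hc hr => ?_⟩
    · have h1 : (intBox ![2 * H₁ / m, 2 * H₂ / m, 2 * H₁ / m, 2 * H₂ / m]).card * m ^ 4
          ≤ 6 ^ 4 * (H₁ * H₂) ^ 2 := by
        rw [card_intBox, Fin.prod_univ_four]
        have e1 := two_mul_div_add_one_mul_le (a := H₁) (m := m) (by lia)
        have e2 := two_mul_div_add_one_mul_le (a := H₂) (m := m) (by lia)
        have e3 := Nat.mul_le_mul (Nat.mul_le_mul e1 e2) (Nat.mul_le_mul e1 e2)
        calc _ = (2 * (2 * H₁ / m) + 1) * m * ((2 * (2 * H₂ / m) + 1) * m) *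
              ((2 * (2 * H₁ / m) + 1) * m * ((2 * (2 * H₂ / m) + 1) * m)) := by
                simp; ring
          _ ≤ _ := e3
          _ = _ := by ring
      refine (Nat.mul_le_mul hk4 Finset.card_image_le).trans ?_
      linarith
    · obtain ⟨y, hy, hy0, hlt⟩ := exists_short_of_finrank_le_two hH₁ hH₂ hr hm1 (hsmall c hc)
      refine Finset.mem_image.2 ⟨y, mem_intBox.2 fun i => ?_,
        (eq_div_of_mem_ratioPoints hH₁ hH₂ hP hy hy0).symm⟩
      have := (hlt i).le
      fin_cases i <;> exact le_div_of_mul_abs_le hm1 (by push_cast; exact this)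
  · set q := (k - 1) / (2 * H₂) with hq
    have hm2 : (2 * H₂) ^ 2 ≤ m ^ 2 := Nat.pow_le_pow_left hmH 2
    have hq2 : 2 * H₂ ≤ q := (Nat.le_div_iff_mul_le (by lia)).2 (by
      rw [← sq]; lia)
    have hqk : 2 * H₂ * q < k := by
      have := Nat.mul_div_le (k - 1) (2 * H₂)
      rw [← hq] at this; lia
    have hkq : k ≤ 4 * H₂ * q := by
      have := Nat.lt_mul_div_succ (k - 1) (show 0 < 2 * H₂ by lia)
      rw [← hq] at this
      have h2 : 2 * H₂ * (q + 1) ≤ 4 * H₂ * q := by nlinarith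
      lia
    by_cases hqH : q ≤ 2 * H₁
    · refine ⟨(intBox ![2 * H₁ / q, 2 * H₁ / q]).image fun y : Fin 2 → ℤ =>
        (a₁ * (y 0 : ℤ)) / (a₁ * (y 1 : ℤ)), ?_, fun c hc hr => ?_⟩
      · have h1 : (intBox ![2 * H₁ / q, 2 * H₁ / q]).card * q ^ 2 ≤ 6 ^ 2 * H₁ ^ 2 := by
          rw [card_intBox, Fin.prod_univ_two]
          have e1 := two_mul_div_add_one_mul_le (a := H₁) (m := q) hqH
          calc _ = (2 * (2 * H₁ / q) + 1) * q * ((2 * (2 * H₁ / q) + 1) * q) := by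
                simp; ring
            _ ≤ _ := Nat.mul_le_mul e1 e1
            _ = _ := by ring
        calc _ ≤ (4 * H₂ * q) ^ 2 * (intBox ![2 * H₁ / q, 2 * H₁ / q]).card :=
              Nat.mul_le_mul (Nat.pow_le_pow_left hkq 2) Finset.card_image_le
          _ = 16 * H₂ ^ 2 * ((intBox ![2 * H₁ / q, 2 * H₁ / q]).card * q ^ 2) := by ring
          _ ≤ 16 * H₂ ^ 2 * (6 ^ 2 * H₁ ^ 2) := Nat.mul_le_mul_left _ h1
          _ = 16 * 6 ^ 2 * (H₁ * H₂) ^ 2 := by ring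
          _ ≤ _ := by gcongr <;> norm_num
      · obtain ⟨y, hy, hy0, hlt⟩ := exists_short_of_finrank_le_two hH₁ hH₂ hr hm1 (hsmall c hc)
        have hzero : ∀ x : ℤ, m * |x| < 2 * H₂ → x = 0 := fun x hx =>
          eq_zero_of_mul_abs_lt hx (by positivity) (by exact_mod_cast hmH)
        obtain ⟨z, hz, hz0, hz1, hz3, hb0, hb2⟩ :=
          exists_short_of_finrank_le_two_of_degenerate ha₁ hH₁ hH₂ (hKp c hc) hr hy hy0
            (hzero _ (hlt 1)) (hzero _ (hlt 3)) (q := q) (by lia) (hqk.trans_le hc)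
        refine Finset.mem_image.2 ⟨![z 0, z 2], mem_intBox.2 fun i => ?_, ?_⟩
        · fin_cases i
          · exact le_div_of_mul_abs_le (by lia) (by push_cast; exact hb0.le)
          · exact le_div_of_mul_abs_le (by lia) (by push_cast; exact hb2.le)
        · rw [eq_div_of_mem_ratioPoints hH₁ hH₂ hP hz hz0, hz1, hz3]
          simp
    · refine ⟨∅, by simp, fun c hc hr => ?_⟩
      exfalso
      obtain ⟨y, hy, hy0, hlt⟩ := exists_short_of_finrank_le_two hH₁ hH₂ hr hm1 (hsmall c hc)
      have hzero : ∀ x : ℤ, m * |x| < 2 * H₂ → x = 0 := fun x hx =>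
        eq_zero_of_mul_abs_lt hx (by positivity) (by exact_mod_cast hmH)
      obtain ⟨z, hz, hz0, hz1, hz3, hb0, hb2⟩ :=
        exists_short_of_finrank_le_two_of_degenerate ha₁ hH₁ hH₂ (hKp c hc) hr hy hy0
          (hzero _ (hlt 1)) (hzero _ (hlt 3)) (q := q) (by lia) (hqk.trans_le hc)
      have hq' : (2 * H₁ : ℤ) < q := by exact_mod_cast not_le.1 hqH
      have hzero' : ∀ x : ℤ, q * |x| < 2 * H₁ → x = 0 := fun x hx =>
        eq_zero_of_mul_abs_lt hx (by positivity) hq'.le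
      refine hz0 (funext fun i => ?_)
      fin_cases i
      exacts [hzero' _ hb0, hz1, hzero' _ hb2, hz3]

/-- The number of representations `x = c * y` with `x, y ∈ A`, `y ≠ 0`. -/
def quotCount {p : ℕ} (A : Finset (ZMod p)) (c : ZMod p) : ℕ :=
  ((A ×ˢ A).filter fun x => x.2 ≠ 0 ∧ x.1 = c * x.2).card

theorem quotCount_le_card {p : ℕ} (A : Finset (ZMod p)) (c : ZMod p) : quotCount A c ≤ A.card := by
  refine Finset.card_le_card_of_injOn Prod.snd (fun x hx => ?_) fun x hx y hy hxy => ?_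
  · exact (Finset.mem_product.1 (Finset.mem_filter.1 hx).1).2
  · have h1 := (Finset.mem_filter.1 hx).2.2
    have h2 := (Finset.mem_filter.1 hy).2.2
    exact Prod.ext (by rw [h1, h2, hxy]) hxy

theorem sum_quotCount_le {p : ℕ} [Fact p.Prime] (A : Finset (ZMod p)) :
    ∑ c, quotCount A c ≤ A.card ^ 2 := by
  rw [sq, ← Finset.card_product]
  unfold quotCount
  rw [← Finset.card_biUnion]
  · exact Finset.card_le_card (Finset.biUnion_subset.2 fun c _ => Finset.filter_subset _ _)
  · refine fun c _ d _ hcd => Finset.disjoint_left.2 fun x hx hx' => hcd ?_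
    obtain ⟨-, h0, h1⟩ := Finset.mem_filter.1 hx
    obtain ⟨-, -, h2⟩ := Finset.mem_filter.1 hx'
    exact mul_right_cancel₀ h0 (h1.symm.trans h2)

theorem multEnergy_le {p : ℕ} [Fact p.Prime] (A : Finset (ZMod p)) :
    multEnergy A ≤ 4 * A.card ^ 2 + ∑ c ∈ Finset.univ.filter (· ≠ 0), quotCount A c ^ 2 := by
  set F : ZMod p → Finset (ZMod p × ZMod p) := fun c =>
    (A ×ˢ A).filter fun x => x.2 ≠ 0 ∧ x.1 = c * x.2
  have hsub : ((A ×ˢ A) ×ˢ (A ×ˢ A)).filter (fun q => q.1.1 * q.1.2 = q.2.1 * q.2.2) ⊆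
      ((A ×ˢ A).image fun x => ((x.1, 0), (0, x.2))) ∪
      ((A ×ˢ A).image fun x => ((x.1, 0), (x.2, 0))) ∪
      ((A ×ˢ A).image fun x => ((0, x.1), (0, x.2))) ∪
      ((A ×ˢ A).image fun x => ((0, x.1), (x.2, 0))) ∪
      (Finset.univ.filter (· ≠ 0)).biUnion fun c =>
        (F c ×ˢ F c).image fun x => ((x.1.1, x.2.2), (x.1.2, x.2.1)) := by
    rintro ⟨⟨s₁, s₂⟩, s₃, s₄⟩ hs
    simp only [Finset.mem_filter, Finset.mem_product] at hs
    obtain ⟨⟨⟨h1, h2⟩, h3, h4⟩, hs⟩ := hs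
    simp only [Finset.mem_union, Finset.mem_image, Finset.mem_product, Finset.mem_biUnion,
      Finset.mem_filter, Finset.mem_univ, true_and, Prod.exists, Prod.mk.injEq, F]
    by_cases hs3 : s₃ = 0
    · subst hs3
      rcases mul_eq_zero.1 (hs.trans (zero_mul _)) with rfl | rfl
      · exact Or.inl (Or.inl (Or.inr ⟨s₂, s₄, by simp [h2, h4]⟩))
      · exact Or.inl (Or.inl (Or.inl (Or.inl ⟨s₁, s₄, by simp [h1, h4]⟩)))
    by_cases hs2 : s₂ = 0
    · subst hs2
      obtain rfl := (mul_eq_zero.1 (hs.symm.trans (mul_zero _))).resolve_left hs3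
      exact Or.inl (Or.inl (Or.inl (Or.inr ⟨s₁, s₃, by simp [h1, h3]⟩)))
    by_cases hs1 : s₁ = 0
    · subst hs1
      obtain rfl := (mul_eq_zero.1 (hs.symm.trans (zero_mul _))).resolve_left hs3
      exact Or.inl (Or.inr ⟨s₂, s₃, by simp [h2, h3]⟩)
    · refine Or.inr ⟨s₁ / s₃, div_ne_zero hs1 hs3, s₁, s₃, s₄, s₂, ⟨⟨⟨h1, h3⟩, hs3, ?_⟩,
        ⟨h4, h2⟩, hs2, ?_⟩, ⟨rfl, rfl⟩, rfl, rfl⟩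
      · field_simp
      · field_simp; linear_combination -hs
  refine (Finset.card_le_card hsub).trans ((Finset.card_union_le _ _).trans (Nat.add_le_add ?_ ?_))
  · have hc : ∀ f : ZMod p × ZMod p → (ZMod p × ZMod p) × (ZMod p × ZMod p),
        ((A ×ˢ A).image f).card ≤ A.card ^ 2 := fun f =>
      Finset.card_image_le.trans (by rw [Finset.card_product, sq])
    refine (Finset.card_union_le _ _).trans ?_
    refine (Nat.add_le_add_right (Finset.card_union_le _ _) _).trans ?_
    refine (Nat.add_le_add_right (Nat.add_le_add_right (Finset.card_union_le _ _) _) _).trans ?_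
    refine (Nat.add_le_add (Nat.add_le_add (Nat.add_le_add (hc _) (hc _)) (hc _)) (hc _)).trans ?_
    exact le_of_eq (by ring)
  · refine Finset.card_biUnion_le.trans (Finset.sum_le_sum fun c _ => ?_)
    exact Finset.card_image_le.trans (by rw [Finset.card_product, sq]; rfl)

theorem sum_sq_le_of_card_superlevel_le {ι : Type*} (G : Finset ι) (K : ι → ℕ) (N : ℕ)
    (hN : ∀ c ∈ G, K c ≤ N) {B : ℝ} (hB0 : 0 ≤ B)
    (hB : ∀ k : ℕ, 1 ≤ k → (k : ℝ) ^ 2 * (G.filter fun c => k ≤ K c).card ≤ B) :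
    ∑ c ∈ G, (K c : ℝ) ^ 2 ≤ 2 * B * (1 + Real.log N) := by
  have hsq : ∀ n : ℕ, n ^ 2 ≤ ∑ k ∈ Finset.Icc 1 n, 2 * k := by
    intro n
    induction n with
    | zero => simp
    | succ n ih =>
      rw [Finset.sum_Icc_succ_top (by lia)]
      lia
  calc ∑ c ∈ G, (K c : ℝ) ^ 2
      ≤ ∑ c ∈ G, ∑ k ∈ Finset.Icc 1 N, (if k ≤ K c then 2 * (k : ℝ) else 0) := by
        refine Finset.sum_le_sum fun c hc => ?_
        rw [← Finset.sum_filter]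
        have : (Finset.Icc 1 N).filter (· ≤ K c) = Finset.Icc 1 (K c) := by
          ext k
          have := hN c hc
          simp only [Finset.mem_filter, Finset.mem_Icc]
          lia
        rw [this]
        exact_mod_cast hsq (K c)
    _ = ∑ k ∈ Finset.Icc 1 N, 2 * (k : ℝ) * (G.filter fun c => k ≤ K c).card := by
        rw [Finset.sum_comm]
        refine Finset.sum_congr rfl fun k _ => ?_
        rw [← Finset.sum_filter, Finset.sum_const, nsmul_eq_mul, mul_comm]
    _ ≤ ∑ k ∈ Finset.Icc 1 N, 2 * B * (k : ℝ)⁻¹ := by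
        refine Finset.sum_le_sum fun k hk => ?_
        have hk1 := (Finset.mem_Icc.1 hk).1
        have hk0 : (0 : ℝ) < k := by exact_mod_cast hk1
        have := hB k hk1
        rw [← div_eq_mul_inv, le_div_iff₀ hk0]
        linarith
    _ = 2 * B * (harmonic N : ℚ) := by
        rw [← Finset.mul_sum, harmonic_eq_sum_Icc]; push_cast; rfl
    _ ≤ _ := mul_le_mul_of_nonneg_left (harmonic_le_one_add_log N) (by positivity)

theorem card_ratioPoints_le {p : ℕ} (a₁ a₂ c : ZMod p) {H₁ H₂ : ℕ} (hH₁ : 0 < H₁) (hH₂ : 0 < H₂) :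
    (ratioPoints a₁ a₂ c H₁ H₂).card ≤ (4 * (H₁ * H₂)) ^ 2 := by
  refine (Finset.card_filter_le _ _).trans ?_
  rw [card_intBox, Fin.prod_univ_four]
  simp only [Matrix.cons_val_zero, Matrix.cons_val_one, Matrix.cons_val]
  have h1 : 2 * (H₁ - 1) + 1 ≤ 2 * H₁ := by lia
  have h2 : 2 * (H₂ - 1) + 1 ≤ 2 * H₂ := by lia
  calc _ ≤ 2 * H₁ * (2 * H₂) * (2 * H₁) * (2 * H₂) := by gcongr
    _ = _ := by ring

theorem sq_mul_card_ratios_le {p : ℕ} [Fact p.Prime] {a₁ a₂ : ZMod p} (ha₁ : a₁ ≠ 0)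
    (ha₂ : a₂ ≠ 0) {H₁ H₂ : ℕ} (hH₁ : 0 < H₁) (hH₂ : 0 < H₂) (hH : H₂ ≤ H₁)
    (hP : IsProperBox a₁ a₂ H₁ H₂) (G : Finset (ZMod p))
    (hG : ∀ c ∈ G, c ≠ 0 ∧ 2 ≤ (ratioPoints a₁ a₂ c H₁ H₂).card ∧
      13 ^ 4 * (H₁ * H₂) ^ 2 < (ratioPoints a₁ a₂ c H₁ H₂).card * p) (k : ℕ) :
    k ^ 2 * (G.filter fun c => k ≤ (ratioPoints a₁ a₂ c H₁ H₂).card).card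
      ≤ richConst * (H₁ * H₂) ^ 2 := by
  have hp : 0 < p := (Fact.out : p.Prime).pos
  set k' := max k (max 2 (13 ^ 4 * (H₁ * H₂) ^ 2 / p + 1)) with hk'
  refine le_trans (Nat.mul_le_mul (Nat.pow_le_pow_left (le_max_left k _) 2)
    (Finset.card_le_card fun c hc => ?_)) (sq_mul_card_richRatios_le ha₁ ha₂ hH₁ hH₂ hH hP
      (k := k') (by lia) ?_)
  · obtain ⟨hcG, hck⟩ := Finset.mem_filter.1 hc
    obtain ⟨hc0, h2, hlt⟩ := hG c hcG
    exact Finset.mem_filter.2 ⟨Finset.mem_univ _, hc0, max_le hck (max_le h2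
      (Nat.succ_le_of_lt ((Nat.div_lt_iff_lt_mul hp).2 hlt)))⟩
  · exact (Nat.div_lt_iff_lt_mul hp).1 (by lia)

/-- The upper bound for the energy of a set of size `n`, up to a constant. -/
noncomputable def energyBound (p n : ℕ) : ℝ := ((n : ℝ) ^ 2 + (n : ℝ) ^ 4 / p) * Real.log p

/-- The constant in the bound for the energy. -/
noncomputable def energyConst : ℝ := 58 + 18 * 13 ^ 4 + 1296 * richConst

theorem one_le_two_mul_log {p : ℕ} (hp : 2 ≤ p) : 1 ≤ 2 * Real.log p := by
  have h1 := Real.log_two_gt_d9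
  have h2 : Real.log 2 ≤ Real.log p := Real.log_le_log (by norm_num) (by exact_mod_cast hp)
  linarith

theorem one_add_log_sixteen_mul_sq_le {p : ℕ} (hp : 2 ≤ p) :
    1 + Real.log ((4 * p : ℕ) ^ 2 : ℕ) ≤ 8 * Real.log p := by
  have h1 := one_le_two_mul_log hp
  have h2 : Real.log 2 ≤ Real.log p := Real.log_le_log (by norm_num) (by exact_mod_cast hp)
  have hp0 : (p : ℝ) ≠ 0 := by positivity
  have h4 : Real.log 4 = 2 * Real.log 2 := by
    rw [show (4 : ℝ) = 2 ^ 2 by norm_num, Real.log_pow]; norm_num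
  push_cast
  rw [Real.log_pow, Real.log_mul (by norm_num) hp0, h4]
  push_cast
  linarith

theorem sum_sq_le_energyBound {p : ℕ} [Fact p.Prime] {a₁ a₂ : ZMod p} (ha₁ : a₁ ≠ 0)
    (ha₂ : a₂ ≠ 0) {H₁ H₂ : ℕ} (hH₁ : 0 < H₁) (hH₂ : 0 < H₂) (hH : H₂ ≤ H₁)
    (hP : IsProperBox a₁ a₂ H₁ H₂) {n : ℕ} (hPn : H₁ * H₂ ≤ n) (hn : n ≤ p) (r : ZMod p → ℕ)
    (hr : ∀ c, r c ≤ 9 * (ratioPoints a₁ a₂ c H₁ H₂).card) (hsum : ∑ c, r c ≤ n ^ 2) :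
    ∑ c ∈ Finset.univ.filter (· ≠ 0), (r c : ℝ) ^ 2
      ≤ (18 * 13 ^ 4 + 1296 * richConst) * energyBound p n := by
  have hp2 : 2 ≤ p := (Fact.out : p.Prime).two_le
  have hp0 : (0 : ℝ) < p := by positivity
  have hlog := one_le_two_mul_log hp2
  have hPn' : ((H₁ * H₂ : ℕ) : ℝ) ≤ n := by exact_mod_cast hPn
  have hPn2 : ((H₁ * H₂ : ℕ) : ℝ) ^ 2 ≤ (n : ℝ) ^ 2 := by gcongr
  have hsum' : ∑ c, (r c : ℝ) ≤ (n : ℝ) ^ 2 := by exact_mod_cast hsum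
  set K := fun c => (ratioPoints a₁ a₂ c H₁ H₂).card with hK
  set Q : ZMod p → Prop := fun c => 2 ≤ K c ∧ 13 ^ 4 * (H₁ * H₂) ^ 2 < K c * p with hQ
  have hr' : ∀ c, (r c : ℝ) ≤ 9 * K c := fun c => by exact_mod_cast hr c
  rw [← Finset.sum_filter_add_sum_filter_not _ Q]
  have hrich : ∑ c ∈ (Finset.univ.filter (· ≠ 0)).filter Q, (r c : ℝ) ^ 2
      ≤ 1296 * richConst * energyBound p n := by
    have h1 := sum_sq_le_of_card_superlevel_le ((Finset.univ.filter (· ≠ 0)).filter Q) K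
      ((4 * p) ^ 2) (fun c _ => (card_ratioPoints_le a₁ a₂ c hH₁ hH₂).trans
        (Nat.pow_le_pow_left (Nat.mul_le_mul_left 4 (hPn.trans hn)) 2))
      (B := richConst * ((H₁ * H₂ : ℕ) : ℝ) ^ 2) (by positivity) (fun k _ => by
        exact_mod_cast sq_mul_card_ratios_le ha₁ ha₂ hH₁ hH₂ hH hP _ (fun c hc => by
          obtain ⟨hc0, hcQ⟩ := Finset.mem_filter.1 hc
          exact ⟨(Finset.mem_filter.1 hc0).2, hcQ⟩) k)
    calc _ ≤ ∑ c ∈ (Finset.univ.filter (· ≠ 0)).filter Q, 81 * (K c : ℝ) ^ 2 := by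
          refine Finset.sum_le_sum fun c _ => ?_
          calc (r c : ℝ) ^ 2 ≤ (9 * K c) ^ 2 := pow_le_pow_left₀ (by positivity) (hr' c) 2
            _ = _ := by ring
      _ = 81 * ∑ c ∈ (Finset.univ.filter (· ≠ 0)).filter Q, (K c : ℝ) ^ 2 :=
          (Finset.mul_sum _ _ _).symm
      _ ≤ 81 * (2 * (richConst * ((H₁ * H₂ : ℕ) : ℝ) ^ 2) * (8 * Real.log p)) := by
          refine mul_le_mul_of_nonneg_left (h1.trans ?_) (by norm_num)
          exact mul_le_mul_of_nonneg_left (one_add_log_sixteen_mul_sq_le hp2) (by positivity)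
      _ = 1296 * richConst * (((H₁ * H₂ : ℕ) : ℝ) ^ 2 * Real.log p) := by ring
      _ ≤ _ := by
          rw [energyBound]
          have : ((H₁ * H₂ : ℕ) : ℝ) ^ 2 ≤ (n : ℝ) ^ 2 + (n : ℝ) ^ 4 / p :=
            hPn2.trans (le_add_of_nonneg_right (by positivity))
          gcongr
  have hpoor : ∑ c ∈ (Finset.univ.filter (· ≠ 0)).filter (fun c => ¬ Q c), (r c : ℝ) ^ 2
      ≤ 18 * 13 ^ 4 * energyBound p n := by
    calc _ ≤ ∑ c ∈ (Finset.univ.filter (· ≠ 0)).filter (fun c => ¬ Q c),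
            (9 * 13 ^ 4 * (1 + (n : ℝ) ^ 2 / p)) * r c := by
          refine Finset.sum_le_sum fun c hc => ?_
          have hcQ := (Finset.mem_filter.1 hc).2
          have hKc : (K c : ℝ) ≤ 13 ^ 4 * (1 + (n : ℝ) ^ 2 / p) := by
            have h0 : (0 : ℝ) ≤ (n : ℝ) ^ 2 / p := by positivity
            rcases not_and_or.1 hcQ with h | h
            · have : (K c : ℝ) ≤ 1 := by exact_mod_cast Nat.lt_succ_iff.1 (not_le.1 h)
              linarith
            · have h2 : (K c : ℝ) * p ≤ 13 ^ 4 * ((H₁ * H₂ : ℕ) : ℝ) ^ 2 := by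
                exact_mod_cast not_lt.1 h
              have h3 : (K c : ℝ) ≤ 13 ^ 4 * (n : ℝ) ^ 2 / p := by
                rw [le_div_iff₀ hp0]; linarith
              rw [mul_div_assoc] at h3
              linarith
          rw [sq]
          refine mul_le_mul_of_nonneg_right ((hr' c).trans ?_) (by positivity)
          linarith
      _ = (9 * 13 ^ 4 * (1 + (n : ℝ) ^ 2 / p)) *
            ∑ c ∈ (Finset.univ.filter (· ≠ 0)).filter (fun c => ¬ Q c), (r c : ℝ) :=
          (Finset.mul_sum _ _ _).symm
      _ ≤ (9 * 13 ^ 4 * (1 + (n : ℝ) ^ 2 / p)) * (n : ℝ) ^ 2 := by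
          refine mul_le_mul_of_nonneg_left (le_trans ?_ hsum') (by positivity)
          exact Finset.sum_le_sum_of_subset_of_nonneg (Finset.subset_univ _)
            fun _ _ _ => by positivity
      _ = 9 * 13 ^ 4 * ((n : ℝ) ^ 2 + (n : ℝ) ^ 4 / p) * 1 := by ring
      _ ≤ 9 * 13 ^ 4 * ((n : ℝ) ^ 2 + (n : ℝ) ^ 4 / p) * (2 * Real.log p) :=
          mul_le_mul_of_nonneg_left hlog (by positivity)
      _ = _ := by rw [energyBound]; ring
  linarith

theorem quotCount_le_of_cover {p : ℕ} {a₁ a₂ : ZMod p} {H₁ H₂ : ℕ} (hH₁ : 0 < H₁) (hH₂ : 0 < H₂)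
    {A : Finset (ZMod p)} (b : Fin 3 → ZMod p)
    (hcov : ∀ x ∈ A, ∃ t, ∃ u ∈ Finset.Icc (1 : ℤ) H₁, ∃ v ∈ Finset.Icc (1 : ℤ) H₂,
      x = b t + a₁ * (u : ℤ) + a₂ * (v : ℤ)) (c : ZMod p) :
    quotCount A c ≤ 9 * (ratioPoints a₁ a₂ c H₁ H₂).card := by
  have hcov' : ∀ x, ∃ t : Fin 3, ∃ u v : ℤ, x ∈ A → (u ∈ Finset.Icc (1 : ℤ) H₁ ∧
      v ∈ Finset.Icc (1 : ℤ) H₂ ∧ x = b t + a₁ * (u : ℤ) + a₂ * (v : ℤ)) := fun x => by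
    by_cases hx : x ∈ A
    · obtain ⟨t, u, hu, v, hv, h⟩ := hcov x hx
      exact ⟨t, u, v, fun _ => ⟨hu, hv, h⟩⟩
    · exact ⟨0, 0, 0, fun h => absurd h hx⟩
  choose t u v h using hcov'
  set F := (A ×ˢ A).filter fun x => x.2 ≠ 0 ∧ x.1 = c * x.2 with hF
  have hmem : ∀ x ∈ F, x.1 ∈ A ∧ x.2 ∈ A ∧ x.1 = c * x.2 := fun x hx => by
    obtain ⟨h1, -, h2⟩ := Finset.mem_filter.1 hx
    exact ⟨(Finset.mem_product.1 h1).1, (Finset.mem_product.1 h1).2, h2⟩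
  have key := Finset.card_le_mul_card_image (f := fun x : ZMod p × ZMod p => (t x.1, t x.2)) F
    (ratioPoints a₁ a₂ c H₁ H₂).card (fun q hq => ?_)
  · have h9 : (F.image fun x => (t x.1, t x.2)).card ≤ 9 := by
      simpa using Finset.card_le_univ (F.image fun x => (t x.1, t x.2))
    refine (key.trans (Nat.mul_le_mul_left _ h9)).trans (Nat.mul_comm _ _).le
  · obtain ⟨x₀, hx₀, rfl⟩ := Finset.mem_image.1 hq
    obtain ⟨hA1, hA2, hA⟩ := hmem x₀ hx₀
    obtain ⟨hu1, hv1, he1⟩ := h _ hA1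
    obtain ⟨hu2, hv2, he2⟩ := h _ hA2
    refine Finset.card_le_card_of_injOn (fun x => ![u x.1 - u x₀.1, v x.1 - v x₀.1,
      u x.2 - u x₀.2, v x.2 - v x₀.2]) (fun x hx => ?_) fun x hx y hy hxy => ?_
    · obtain ⟨hxF, hxt⟩ := Finset.mem_filter.1 hx
      obtain ⟨hB1, hB2, hB⟩ := hmem x hxF
      obtain ⟨hu3, hv3, he3⟩ := h _ hB1
      obtain ⟨hu4, hv4, he4⟩ := h _ hB2
      obtain ⟨ht1, ht2⟩ := Prod.ext_iff.1 hxt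
      simp only at ht1 ht2
      rw [ht1] at he3
      rw [ht2] at he4
      rw [Finset.mem_Icc] at hu1 hu2 hu3 hu4 hv1 hv2 hv3 hv4
      refine (mem_ratioPoints hH₁ hH₂).2 ⟨fun i => ?_, ?_⟩
      · fin_cases i <;> simp [abs_lt] <;> lia
      · simp only [ratioForm_apply, Matrix.cons_val_zero, Matrix.cons_val_one, Matrix.cons_val]
        push_cast
        linear_combination hB - hA - he3 + he1 + c * he4 - c * he2
    · obtain ⟨hxF, hxt⟩ := Finset.mem_filter.1 hx
      obtain ⟨hyF, hyt⟩ := Finset.mem_filter.1 hy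
      obtain ⟨hB1, hB2, hB⟩ := hmem x hxF
      obtain ⟨hC1, hC2, hC⟩ := hmem y hyF
      obtain ⟨ht1, ht2⟩ := Prod.ext_iff.1 (hxt.trans hyt.symm)
      simp only at ht1 ht2
      have e0 : u x.1 = u y.1 := by simpa using congrFun hxy 0
      have e1 : v x.1 = v y.1 := by simpa using congrFun hxy 1
      have e2 : u x.2 = u y.2 := by simpa using congrFun hxy 2
      have e3 : v x.2 = v y.2 := by simpa using congrFun hxy 3
      refine Prod.ext ?_ ?_
      · rw [(h _ hB1).2.2, (h _ hC1).2.2, ht1, e0, e1]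
      · rw [(h _ hB2).2.2, (h _ hC2).2.2, ht2, e2, e3]

theorem mul_le_card_of_isProperBox {p : ℕ} {a₁ a₂ : ZMod p} {H₁ H₂ : ℕ}
    (hP : IsProperBox a₁ a₂ H₁ H₂) {A : Finset (ZMod p)} (b : ZMod p)
    (hsub : ∀ u ∈ Finset.Icc (1 : ℤ) H₁, ∀ v ∈ Finset.Icc (1 : ℤ) H₂,
      b + a₁ * (u : ℤ) + a₂ * (v : ℤ) ∈ A) : H₁ * H₂ ≤ A.card := by
  have : ((Finset.Icc (1 : ℤ) H₁) ×ˢ (Finset.Icc (1 : ℤ) H₂)).card = H₁ * H₂ := by simp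
  rw [← this]
  refine Finset.card_le_card_of_injOn (fun x => b + a₁ * (x.1 : ℤ) + a₂ * (x.2 : ℤ))
    (fun x hx => ?_) fun x hx y hy hxy => ?_
  · obtain ⟨h1, h2⟩ := Finset.mem_product.1 hx
    exact hsub _ h1 _ h2
  · obtain ⟨h1, h2⟩ := Finset.mem_product.1 hx
    obtain ⟨h3, h4⟩ := Finset.mem_product.1 hy
    rw [Finset.mem_Icc] at h1 h2 h3 h4
    simp only at hxy
    obtain ⟨e1, e2⟩ := hP (x.1 - y.1) (x.2 - y.2) (abs_lt.2 (by lia)) (abs_lt.2 (by lia))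
      (by push_cast; linear_combination hxy)
    exact Prod.ext (by lia) (by lia)

theorem IsProperBox.symm {p : ℕ} {a₁ a₂ : ZMod p} {H₁ H₂ : ℕ} (hP : IsProperBox a₁ a₂ H₁ H₂) :
    IsProperBox a₂ a₁ H₂ H₁ := fun x₁ x₂ h1 h2 h =>
  (hP x₂ x₁ h2 h1 (by linear_combination h)).symm

theorem sq_le_energyBound {p : ℕ} (hp : 2 ≤ p) (n : ℕ) : (n : ℝ) ^ 2 ≤ 2 * energyBound p n := by
  have hlog := one_le_two_mul_log hp
  have h1 : (0 : ℝ) ≤ (n : ℝ) ^ 4 / p := by positivity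
  calc (n : ℝ) ^ 2 ≤ ((n : ℝ) ^ 2 + (n : ℝ) ^ 4 / p) * 1 := by linarith
    _ ≤ ((n : ℝ) ^ 2 + (n : ℝ) ^ 4 / p) * (2 * Real.log p) :=
      mul_le_mul_of_nonneg_left hlog (by positivity)
    _ = _ := by rw [energyBound]; ring

theorem energyBound_nonneg (p n : ℕ) : 0 ≤ energyBound p n :=
  mul_nonneg (by positivity) (Real.log_natCast_nonneg p)

/-- The energy bound for sets covered by three translates of a proper box and containing one. -/
theorem multEnergy_le_of_cover {p : ℕ} [Fact p.Prime] {a₁ a₂ : ZMod p} (ha₁ : a₁ ≠ 0)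
    (ha₂ : a₂ ≠ 0) {H₁ H₂ : ℕ} (hH₁ : 0 < H₁) (hH₂ : 0 < H₂) (hP : IsProperBox a₁ a₂ H₁ H₂)
    {A : Finset (ZMod p)} (b : Fin 3 → ZMod p)
    (hcov : ∀ x ∈ A, ∃ t, ∃ u ∈ Finset.Icc (1 : ℤ) H₁, ∃ v ∈ Finset.Icc (1 : ℤ) H₂,
      x = b t + a₁ * (u : ℤ) + a₂ * (v : ℤ)) (b₀ : ZMod p)
    (hsub : ∀ u ∈ Finset.Icc (1 : ℤ) H₁, ∀ v ∈ Finset.Icc (1 : ℤ) H₂,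
      b₀ + a₁ * (u : ℤ) + a₂ * (v : ℤ) ∈ A) :
    (multEnergy A : ℝ) ≤ energyConst * energyBound p A.card := by
  wlog hH : H₂ ≤ H₁ generalizing a₁ a₂ H₁ H₂
  · refine this ha₂ ha₁ hH₂ hH₁ hP.symm (fun x hx => ?_) (fun u hu v hv => ?_) (by lia)
    · obtain ⟨t, u, hu, v, hv, h⟩ := hcov x hx
      exact ⟨t, v, hv, u, hu, by rw [h]; ring⟩
    · convert hsub v hv u hu using 1
      ring
  have hAp : A.card ≤ p := by simpa [ZMod.card] using Finset.card_le_univ A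
  have h1 := sum_sq_le_energyBound ha₁ ha₂ hH₁ hH₂ hH hP (mul_le_card_of_isProperBox hP b₀ hsub)
    hAp (quotCount A) (quotCount_le_of_cover hH₁ hH₂ b hcov) (sum_quotCount_le A)
  have h2 : (multEnergy A : ℝ) ≤ 4 * (A.card : ℝ) ^ 2
      + ∑ c ∈ Finset.univ.filter (· ≠ 0), (quotCount A c : ℝ) ^ 2 := by
    exact_mod_cast multEnergy_le A
  have h3 := sq_le_energyBound (Fact.out : p.Prime).two_le A.card
  have h4 := energyBound_nonneg p A.card
  rw [energyConst]
  linarith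

/-- The energy bound for sets of positive density. -/
theorem multEnergy_le_of_dense {p : ℕ} [Fact p.Prime] {A : Finset (ZMod p)}
    (hA : p ≤ 25 * A.card) : (multEnergy A : ℝ) ≤ energyConst * energyBound p A.card := by
  have hp2 := (Fact.out : p.Prime).two_le
  have hp0 : (0 : ℝ) < p := by positivity
  have hA' : (p : ℝ) ≤ 25 * A.card := by exact_mod_cast hA
  have h1 : multEnergy A ≤ 4 * A.card ^ 2 + A.card * A.card ^ 2 := by
    refine (multEnergy_le A).trans (Nat.add_le_add_left ?_ _)
    calc _ ≤ ∑ c, A.card * quotCount A c := by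
          refine (Finset.sum_le_sum fun c _ => ?_).trans
            (Finset.sum_le_sum_of_subset (Finset.subset_univ _))
          rw [sq]
          exact Nat.mul_le_mul_right _ (quotCount_le_card A c)
      _ = A.card * ∑ c, quotCount A c := (Finset.mul_sum _ _ _).symm
      _ ≤ _ := Nat.mul_le_mul_left _ (sum_quotCount_le A)
  have h1' : (multEnergy A : ℝ) ≤ 4 * (A.card : ℝ) ^ 2 + (A.card : ℝ) ^ 3 := by
    have : (multEnergy A : ℝ) ≤ 4 * (A.card : ℝ) ^ 2 + A.card * (A.card : ℝ) ^ 2 := by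
      exact_mod_cast h1
    linarith
  have h2 : (A.card : ℝ) ^ 3 ≤ 25 * ((A.card : ℝ) ^ 4 / p) := by
    rw [← mul_div_assoc, le_div_iff₀ hp0]
    calc (A.card : ℝ) ^ 3 * p ≤ (A.card : ℝ) ^ 3 * (25 * A.card) := by gcongr
      _ = _ := by ring
  have h3 : (A.card : ℝ) ^ 2 + (A.card : ℝ) ^ 4 / p ≤ 2 * energyBound p A.card := by
    rw [energyBound]
    have := mul_le_mul_of_nonneg_left (one_le_two_mul_log hp2)
      (show (0 : ℝ) ≤ (A.card : ℝ) ^ 2 + (A.card : ℝ) ^ 4 / p by positivity)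
    linarith
  have h4 := energyBound_nonneg p A.card
  have h5 : 0 ≤ (A.card : ℝ) ^ 2 := by positivity
  have h6 : 0 ≤ (A.card : ℝ) ^ 4 / p := by positivity
  have h7 : 0 ≤ (richConst : ℝ) * energyBound p A.card := by positivity
  rw [energyConst]
  linarith

/-- `A` is the generalized arithmetic progression with base point `a₀`, steps `a₁, a₂` and side
lengths `H₁, H₂`. -/
def IsProgression {p : ℕ} (a₀ a₁ a₂ : ZMod p) (H₁ H₂ : ℕ) (A : Finset (ZMod p)) : Prop :=
  ∀ x, x ∈ A ↔ ∃ u ∈ Finset.Icc (1 : ℤ) H₁, ∃ v ∈ Finset.Icc (1 : ℤ) H₂,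
    x = a₀ + a₁ * (u : ℤ) + a₂ * (v : ℤ)

theorem IsProgression.symm {p : ℕ} {a₀ a₁ a₂ : ZMod p} {H₁ H₂ : ℕ} {A : Finset (ZMod p)}
    (hA : IsProgression a₀ a₁ a₂ H₁ H₂ A) : IsProgression a₀ a₂ a₁ H₂ H₁ A := by
  refine fun x => (hA x).trans ⟨?_, ?_⟩
  all_goals
    rintro ⟨u, hu, v, hv, h⟩
    exact ⟨v, hv, u, hu, by rw [h]; ring⟩

theorem exists_sub_mul_mem_Icc {H : ℕ} (hH : 0 < H) {z : ℤ} (hz : |z| ≤ 2 * H) :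
    ∃ q ∈ Finset.Icc (-3 : ℤ) 1, z - q * H ∈ Finset.Icc (1 : ℤ) H := by
  have hH' : (0 : ℤ) < H := by exact_mod_cast hH
  have h1 := Int.mul_ediv_add_emod (z - 1) H
  have h2 := Int.emod_nonneg (z - 1) hH'.ne'
  have h3 := Int.emod_lt_of_pos (z - 1) hH'
  obtain ⟨h4, h5⟩ := abs_le.1 hz
  refine ⟨(z - 1) / H, Finset.mem_Icc.2 ⟨?_, ?_⟩, Finset.mem_Icc.2 ⟨?_, ?_⟩⟩
  · exact (Int.le_ediv_iff_mul_le hH').2 (by lia)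
  · exact Int.lt_add_one_iff.1 ((Int.ediv_lt_iff_lt_mul hH').2 (by lia))
  · rw [mul_comm]; lia
  · rw [mul_comm]; lia

/-- If a progression has two independent relations, then it has positive density. -/
theorem IsProgression.le_card_of_relations {p : ℕ} [Fact p.Prime] {a₀ a₁ a₂ : ZMod p}
    (ha₁ : a₁ ≠ 0) {H₁ H₂ : ℕ} (hH₁ : 0 < H₁) (hH₂ : 0 < H₂) {A : Finset (ZMod p)}
    (hA : IsProgression a₀ a₁ a₂ H₁ H₂ A) {x₁ x₂ y₁ y₂ : ℤ} (hx₁ : |x₁| < H₁) (hx₂ : |x₂| < H₂)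
    (hx : a₁ * x₁ + a₂ * x₂ = 0) (hy₁ : |y₁| < H₁) (hy₂ : |y₂| < H₂)
    (hy : a₁ * y₁ + a₂ * y₂ = 0) (hdet : x₁ * y₂ - x₂ * y₁ ≠ 0) : p ≤ 25 * A.card := by
  set D := x₁ * y₂ - x₂ * y₁ with hD
  set I : Finset (Fin 2 → ℤ) := {![x₁, x₂], ![y₁, y₂]} with hI
  have hspan : ∀ z ∈ Submodule.span ℤ (I : Set (Fin 2 → ℤ)),
      a₁ * (z 0 : ℤ) + a₂ * (z 1 : ℤ) = 0 := by
    intro z hz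
    rw [hI, Finset.coe_pair, Submodule.mem_span_pair] at hz
    obtain ⟨s, t, rfl⟩ := hz
    simp
    linear_combination s * hx + t * hy
  have hsurj : ∀ w : ZMod p, ∃ q ∈ (Finset.Icc (-3 : ℤ) 1 ×ˢ Finset.Icc (-3 : ℤ) 1) ×ˢ A,
      q.2 - a₀ + a₁ * (q.1.1 * H₁ : ℤ) + a₂ * (q.1.2 * H₂ : ℤ) = w := by
    intro w
    have hmem : D • ![((w / a₁).val : ℤ), 0] - 0 ∈ Submodule.span ℤ (I : Set (Fin 2 → ℤ)) := by
      rw [sub_zero, hI, Finset.coe_pair, Submodule.mem_span_pair]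
      refine ⟨y₂ * (w / a₁).val, -(x₂ * (w / a₁).val), ?_⟩
      ext i
      fin_cases i <;> simp [hD] <;> ring
    obtain ⟨z, hz, hzb⟩ := exists_sub_mem_span_of_smul_sub_mem I ![(H₁ : ℤ), (H₂ : ℤ)]
      (by
        intro v hv i
        rcases Finset.mem_insert.1 hv with rfl | hv
        · fin_cases i <;> simp <;> lia
        · obtain rfl := Finset.mem_singleton.1 hv
          fin_cases i <;> simp <;> lia) hdet hmem
    have hIc : (I.card : ℤ) ≤ 2 := by exact_mod_cast Finset.card_le_two
    have hzb' : ∀ i, |z i| ≤ 2 * (![(H₁ : ℤ), (H₂ : ℤ)] i) := by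
      intro i
      have h0 : (0 : ℤ) ≤ ![(H₁ : ℤ), (H₂ : ℤ)] i := by fin_cases i <;> simp
      have h1 := hzb i
      rw [Pi.zero_apply, abs_zero, zero_add] at h1
      exact (le_of_mul_le_mul_left h1 (abs_pos.2 hdet)).trans (mul_le_mul_of_nonneg_right hIc h0)
    obtain ⟨q₁, hq₁, hr₁⟩ := exists_sub_mul_mem_Icc hH₁ (hzb' 0)
    obtain ⟨q₂, hq₂, hr₂⟩ := exists_sub_mul_mem_Icc hH₂ (hzb' 1)
    refine ⟨((q₁, q₂), a₀ + a₁ * (z 0 - q₁ * H₁ : ℤ) + a₂ * (z 1 - q₂ * H₂ : ℤ)),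
      Finset.mem_product.2 ⟨Finset.mem_product.2 ⟨hq₁, hq₂⟩, (hA _).2 ⟨_, hr₁, _, hr₂, rfl⟩⟩, ?_⟩
    have h1 := hspan _ hz
    have h2 : a₁ * ((w / a₁).val : ZMod p) = w := by
      rw [ZMod.natCast_zmod_val]
      field_simp
    simp at h1 h2 ⊢
    linear_combination h1 + h2
  have := Finset.card_le_card_of_surjOn (s := (Finset.Icc (-3 : ℤ) 1 ×ˢ Finset.Icc (-3 : ℤ) 1) ×ˢ A)
    (t := (Finset.univ : Finset (ZMod p)))
    (fun q => q.2 - a₀ + a₁ * (q.1.1 * H₁ : ℤ) + a₂ * (q.1.2 * H₂ : ℤ)) fun w _ => hsurj w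
  simpa [ZMod.card] using this

/-- The energy bound for a progression whose relations are proportional to a single minimal one. -/
theorem IsProgression.multEnergy_le_of_proportional {p : ℕ} [Fact p.Prime] {a₀ a₁ a₂ : ZMod p}
    (ha₁ : a₁ ≠ 0) (ha₂ : a₂ ≠ 0) {H₁ H₂ : ℕ} (hH₂ : 0 < H₂) {A : Finset (ZMod p)}
    (hA : IsProgression a₀ a₁ a₂ H₁ H₂ A) {u : ℕ} {v : ℤ} (hu0 : 0 < u) (hu : u < H₁)
    (hrel : a₁ * u + a₂ * v = 0) (huv : |v| * H₁ ≤ u * H₂)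
    (hprop : ∀ x₁ x₂ : ℤ, |x₁| < H₁ → |x₂| < H₂ → a₁ * x₁ + a₂ * x₂ = 0 → u * x₂ = v * x₁)
    (hmin : ∀ x₁ x₂ : ℤ, |x₁| < H₁ → |x₂| < H₂ → a₁ * x₁ + a₂ * x₂ = 0 → x₁ ≠ 0 →
      u + |v| ≤ |x₁| + |x₂|) :
    (multEnergy A : ℝ) ≤ energyConst * energyBound p A.card := by
  have hu0' : (0 : ℤ) < u := by exact_mod_cast hu0
  have hP : IsProperBox a₁ a₂ u H₂ := by
    intro x₁ x₂ h1 h2 h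
    have h1' : |x₁| < H₁ := h1.trans (by exact_mod_cast hu)
    have hp := hprop x₁ x₂ h1' h2 h
    by_cases hx : x₁ = 0
    · rw [hx, mul_zero] at hp
      exact ⟨hx, (mul_eq_zero.1 hp).resolve_left hu0'.ne'⟩
    · exfalso
      have h3 := hmin x₁ x₂ h1' h2 h hx
      have h4 : u * |x₂| ≤ u * |v| := by
        calc (u : ℤ) * |x₂| = |v| * |x₁| := by
              rw [← abs_mul v, ← hp, abs_mul, Nat.abs_cast]
          _ ≤ |v| * u := mul_le_mul_of_nonneg_left h1.le (abs_nonneg v)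
          _ = _ := mul_comm _ _
      have h5 := le_of_mul_le_mul_left h4 hu0'
      lia
  refine multEnergy_le_of_cover ha₁ ha₂ hu0 hH₂ hP
    (fun t => a₀ + a₂ * (((t : ℤ) - 1) * H₂ : ℤ)) (fun x hx => ?_) a₀ (fun x hx y hy => ?_)
  · obtain ⟨x₁, hx₁, x₂, hx₂, rfl⟩ := (hA x).1 hx
    rw [Finset.mem_Icc] at hx₁ hx₂
    set q := (x₁ - 1) / u with hq
    have hq0 : 0 ≤ q := Int.ediv_nonneg (by lia) hu0'.le
    have h1 := Int.mul_ediv_add_emod (x₁ - 1) u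
    have h2 := Int.emod_nonneg (x₁ - 1) hu0'.ne'
    have h3 := Int.emod_lt_of_pos (x₁ - 1) hu0'
    rw [← hq] at h1
    have h4 : |q * v| < H₂ := by
      rw [abs_mul, abs_of_nonneg hq0]
      have hH₁' : (0 : ℤ) < H₁ := by lia
      have hH₂' : (0 : ℤ) < H₂ := by exact_mod_cast hH₂
      refine lt_of_mul_lt_mul_right ?_ hH₁'.le
      calc q * |v| * H₁ = q * (|v| * H₁) := by ring
        _ ≤ q * (u * H₂) := mul_le_mul_of_nonneg_left huv hq0
        _ = u * q * H₂ := by ring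
        _ < H₁ * H₂ := mul_lt_mul_of_pos_right (by lia) hH₂'
        _ = _ := mul_comm _ _
    have h5 := abs_lt.1 h4
    have key : ∀ t : Fin 3, a₀ + a₁ * (x₁ : ZMod p) + a₂ * (x₂ : ZMod p) =
        a₀ + a₂ * ((((t : ℕ) : ℤ) - 1) * H₂ : ℤ) + a₁ * ((x₁ - q * u : ℤ) : ZMod p) +
          a₂ * ((x₂ - q * v - (((t : ℕ) : ℤ) - 1) * H₂ : ℤ) : ZMod p) := by
      intro t
      push_cast
      linear_combination q * hrel
    have hr : x₁ - q * u ∈ Finset.Icc (1 : ℤ) u := by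
      rw [Finset.mem_Icc, mul_comm]; lia
    rcases lt_or_ge (x₂ - q * v) 1 with h6 | h6
    · exact ⟨0, _, hr, _, Finset.mem_Icc.2 (by simp; lia), key 0⟩
    rcases le_or_gt (x₂ - q * v) H₂ with h7 | h7
    · exact ⟨1, _, hr, _, Finset.mem_Icc.2 (by simp; lia), key 1⟩
    · exact ⟨2, _, hr, _, Finset.mem_Icc.2 (by simp; lia), key 2⟩
  · rw [Finset.mem_Icc] at hx
    exact (hA _).2 ⟨x, Finset.mem_Icc.2 (by lia), y, hy, rfl⟩

theorem IsProgression.multEnergy_le_of_minimal {p : ℕ} [Fact p.Prime] {a₀ a₁ a₂ : ZMod p}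
    (ha₁ : a₁ ≠ 0) (ha₂ : a₂ ≠ 0) {H₁ H₂ : ℕ} (hH₁ : 0 < H₁) (hH₂ : 0 < H₂) {A : Finset (ZMod p)}
    (hA : IsProgression a₀ a₁ a₂ H₁ H₂ A) {u v : ℤ} (hu : |u| < H₁) (hv : |v| < H₂)
    (hrel : a₁ * u + a₂ * v = 0) (hne : u ≠ 0 ∨ v ≠ 0)
    (hprop : ∀ x₁ x₂ : ℤ, |x₁| < H₁ → |x₂| < H₂ → a₁ * x₁ + a₂ * x₂ = 0 → u * x₂ = v * x₁)
    (hmin : ∀ x₁ x₂ : ℤ, |x₁| < H₁ → |x₂| < H₂ → a₁ * x₁ + a₂ * x₂ = 0 → x₁ ≠ 0 ∨ x₂ ≠ 0 →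
      |u| + |v| ≤ |x₁| + |x₂|) :
    (multEnergy A : ℝ) ≤ energyConst * energyBound p A.card := by
  wlog hH : |v| * H₁ ≤ |u| * H₂ generalizing a₁ a₂ H₁ H₂ u v
  · refine this ha₂ ha₁ hH₂ hH₁ hA.symm hv hu (by linear_combination hrel) hne.symm
      (fun x₁ x₂ h1 h2 h => (hprop x₂ x₁ h2 h1 (by linear_combination h)).symm)
      (fun x₁ x₂ h1 h2 h h0 => ?_) (not_le.1 hH).le
    have := hmin x₂ x₁ h2 h1 (by linear_combination h) h0.symm
    linarith
  wlog hu0 : 0 ≤ u generalizing u v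
  · refine this (u := -u) (v := -v) (by rwa [abs_neg]) (by rwa [abs_neg])
      (by push_cast; linear_combination -hrel) (by simpa using hne)
      (fun x₁ x₂ h1 h2 h => by linear_combination -hprop x₁ x₂ h1 h2 h)
      (fun x₁ x₂ h1 h2 h h0 => by simpa using hmin x₁ x₂ h1 h2 h h0) (by simpa using hH)
      (by linarith)
  lift u to ℕ using hu0
  rw [Nat.abs_cast] at hu hH
  refine hA.multEnergy_le_of_proportional ha₁ ha₂ hH₂ (u := u) (v := v) ?_
    (by exact_mod_cast hu) (by exact_mod_cast hrel) hH hprop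
    fun x₁ x₂ h1 h2 h hx => by simpa using hmin x₁ x₂ h1 h2 h (Or.inl hx)
  rcases Nat.eq_zero_or_pos u with rfl | h
  · exfalso
    rcases hne with h | h
    · simp at h
    · have : 0 < |v| * H₁ := mul_pos (abs_pos.2 h) (by exact_mod_cast hH₁)
      simp at hH
      linarith
  · exact h

theorem IsProgression.multEnergy_le {p : ℕ} [Fact p.Prime] {a₀ a₁ a₂ : ZMod p}
    (ha₁ : a₁ ≠ 0) (ha₂ : a₂ ≠ 0) {H₁ H₂ : ℕ} (hH₁ : 0 < H₁) (hH₂ : 0 < H₂) {A : Finset (ZMod p)}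
    (hA : IsProgression a₀ a₁ a₂ H₁ H₂ A) :
    (multEnergy A : ℝ) ≤ energyConst * energyBound p A.card := by
  by_cases hP : IsProperBox a₁ a₂ H₁ H₂
  · exact multEnergy_le_of_cover ha₁ ha₂ hH₁ hH₂ hP (fun _ => a₀) (fun x hx => ⟨0, (hA x).1 hx⟩)
      a₀ (fun u hu v hv => (hA _).2 ⟨u, hu, v, hv, rfl⟩)
  have hne : ∃ x : ℤ × ℤ, |x.1| < H₁ ∧ |x.2| < H₂ ∧ a₁ * (x.1 : ℤ) + a₂ * (x.2 : ℤ) = 0 ∧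
      (x.1 ≠ 0 ∨ x.2 ≠ 0) := by
    by_contra! h
    exact hP fun x₁ x₂ h1 h2 h3 => by
      by_contra h0
      have := h (x₁, x₂) h1 h2 h3
      tauto
  obtain ⟨⟨u, v⟩, ⟨hu, hv, hrel, h0⟩, hmin⟩ := exists_minimalFor_of_wellFoundedLT
    _ (fun x : ℤ × ℤ => x.1.natAbs + x.2.natAbs) hne
  by_cases hprop : ∀ x₁ x₂ : ℤ, |x₁| < H₁ → |x₂| < H₂ → a₁ * x₁ + a₂ * x₂ = 0 → u * x₂ = v * x₁
  · refine hA.multEnergy_le_of_minimal ha₁ ha₂ hH₁ hH₂ hu hv hrel h0 hprop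
      fun x₁ x₂ h1 h2 h hx => ?_
    rw [Int.abs_eq_natAbs, Int.abs_eq_natAbs, Int.abs_eq_natAbs, Int.abs_eq_natAbs]
    rcases le_total (u.natAbs + v.natAbs) (x₁.natAbs + x₂.natAbs) with hle | hle
    · exact_mod_cast hle
    · exact_mod_cast hmin (j := (x₁, x₂)) ⟨h1, h2, h, hx⟩ hle
  · push Not at hprop
    obtain ⟨x₁, x₂, h1, h2, h, hdet⟩ := hprop
    exact multEnergy_le_of_dense
      (hA.le_card_of_relations ha₁ hH₁ hH₂ hu hv hrel h1 h2 h (sub_ne_zero.2 hdet))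

/-- **Multiplicative energy of rank-2 GAPs.**
There is an absolute constant C > 0 such that every rank-2 GAP A ⊆ F_p satisfies
E_×(A) ≤ C · (|A|² + |A|⁴/p) · log p. -/
theorem stmt1 :
    ∃ C : ℝ, 0 < C ∧
      ∀ (p : ℕ), p.Prime →
      ∀ (H₁ H₂ : ℕ), 0 < H₁ → 0 < H₂ →
      ∀ (a₀ a₁ a₂ : ZMod p), a₁ ≠ 0 → a₂ ≠ 0 →
      ∀ (A : Finset (ZMod p)),
        A = ((Finset.Icc (1 : ℤ) H₁) ×ˢ (Finset.Icc (1 : ℤ) H₂)).image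
              (fun x => a₀ + a₁ * (x.1 : ZMod p) + a₂ * (x.2 : ZMod p)) →
        (multEnergy A : ℝ) ≤ C * ((A.card : ℝ) ^ 2 + (A.card : ℝ) ^ 4 / p) * Real.log p := by
  refine ⟨energyConst, by rw [energyConst]; positivity, ?_⟩
  intro p hp H₁ H₂ hH₁ hH₂ a₀ a₁ a₂ ha₁ ha₂ A hA
  have := Fact.mk hp
  have hA' : IsProgression a₀ a₁ a₂ H₁ H₂ A := by
    intro x
    simp only [hA, Finset.mem_image, Finset.mem_product, Prod.exists]
    constructor
    · rintro ⟨u, v, ⟨hu, hv⟩, rfl⟩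
      exact ⟨u, hu, v, hv, rfl⟩
    · rintro ⟨u, hu, v, hv, rfl⟩
      exact ⟨u, v, ⟨hu, hv⟩, rfl⟩
  rw [mul_assoc]
  exact hA'.multEnergy_le ha₁ ha₂ hH₁ hH₂
end

section
/- For every positive integer d there is a constant C_d such that the following holds. Let p be prime, let a₁, …, a_d ∈ F_p ∖ {0} (identified with integer representatives in {1, …, p−1}), and let η₁, …, η_d ∈ (0, 1/2). Define the Bohr set B = {x ∈ F_p : ‖a_i x / p‖ ≤ η_i for each 1 ≤ i ≤ d}, the box R = [−η₁, η₁] × ⋯ × [−η_d, η_d] ⊆ ℝ^d, and the lattice L = ℤ^d + {p^{−1}(a₁x, …, a_dx) : x ∈ ℤ} ⊆ ℝ^d. Let t be the maximal number of ℝ-linearly independent vectors contained in R ∩ L. Suppose δ > 0 is such that the only integers u₁, …, u_d with |u_i| ≤ δ/η_i for each i and a₁u₁ + ⋯ + a_du_d ≡ 0 (mod p) are u₁ = ⋯ = u_d = 0. Then |B| ≤ C_d · δ^{t−d} · (η₁⋯η_d) · p. -/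
open Finset

/-- Distance from a real number to the nearest integer. -/
noncomputable def distToInt (x : ℝ) : ℝ := |x - round x|

/-- A finite set containing a basis contains a basis with respect to which all of its elements
have coordinates bounded by one (the basis of maximal determinant). -/
theorem exists_basis_abs_repr_le_one {V : Type*} [AddCommGroup V] [Module ℝ V] {n : ℕ}
    (e : Module.Basis (Fin n) ℝ V) {S : Set V} (hS : S.Finite) (he : ∀ i, e i ∈ S) :
    ∃ b : Module.Basis (Fin n) ℝ V, (∀ i, b i ∈ S) ∧ ∀ y ∈ S, ∀ i, |b.repr y i| ≤ 1 := by
  classical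
  have : Finite S := hS
  have : Nonempty (Fin n → S) := ⟨fun i => ⟨e i, he i⟩⟩
  obtain ⟨w, hw⟩ := Finite.exists_max (fun w : Fin n → S => |e.det fun i => (w i : V)|)
  have hpos : 0 < |e.det fun i => (w i : V)| := by
    have h := hw fun i => ⟨e i, he i⟩
    have h1 : e.det (fun i => e i) = 1 := e.det_self
    simp only [h1, abs_one] at h
    linarith
  obtain ⟨hli, hsp⟩ := (Module.Basis.is_basis_iff_det e).2
    (isUnit_iff_ne_zero.2 (abs_pos.1 hpos))
  refine ⟨Module.Basis.mk hli hsp.ge, fun i => by simp, fun y hy i => ?_⟩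
  have h := DFunLike.congr_fun (Module.Basis.det_smul_mk_coord_eq_det_update e hli hsp.ge i) y
  have h2 := hw (Function.update w i ⟨y, hy⟩)
  have h3 : (fun j => ((Function.update w i ⟨y, hy⟩ : Fin n → S) j : V)) =
      Function.update (fun j => (w j : V)) i y := by
    funext j
    rcases eq_or_ne j i with rfl | hj
    · simp
    · simp [hj]
  simp only [h3] at h2
  simp only [LinearMap.smul_apply, smul_eq_mul, Module.Basis.coord_apply] at h
  have h4 : |e.det (fun j => (w j : V))| * |(Module.Basis.mk hli hsp.ge).repr y i| ≤
      |e.det (fun j => (w j : V))| * 1 := by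
    rw [← abs_mul, h, mul_one]
    exact h2
  exact le_of_mul_le_mul_left h4 hpos

/-- A finite set spanning a space of dimension `t` contains `t` linearly independent vectors
such that all its elements are combinations of them with coefficients bounded by one. -/
theorem exists_linearIndependent_abs_coeff_le_one {E : Type*} [AddCommGroup E] [Module ℝ E]
    [FiniteDimensional ℝ E] {S : Set E} (hS : S.Finite) :
    ∃ f : Fin (Module.finrank ℝ (Submodule.span ℝ S)) → E, (∀ i, f i ∈ S) ∧
      LinearIndependent ℝ f ∧
      ∀ y ∈ S, ∃ c : Fin (Module.finrank ℝ (Submodule.span ℝ S)) → ℝ,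
        (∀ i, |c i| ≤ 1) ∧ y = ∑ i, c i • f i := by
  obtain ⟨g, hgS, -, hgli⟩ := Submodule.exists_fun_fin_finrank_span_eq ℝ S
  let V := Submodule.span ℝ S
  let g' : Fin (Module.finrank ℝ V) → V := fun i => ⟨g i, Submodule.subset_span (hgS i)⟩
  have hli : LinearIndependent ℝ g' := LinearIndependent.of_comp V.subtype hgli
  let e := basisOfLinearIndependentOfCardEqFinrank' g' hli (by simp)
  obtain ⟨b, hb, hrep⟩ := exists_basis_abs_repr_le_one e
    (S := ((↑) : V → E) ⁻¹' S) (hS.preimage Subtype.val_injective.injOn)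
    (fun i => by simpa [e, g'] using hgS i)
  refine ⟨fun i => b i, hb, b.linearIndependent.map' V.subtype V.ker_subtype, fun y hy => ?_⟩
  let y' : V := ⟨y, Submodule.subset_span hy⟩
  refine ⟨fun i => b.repr y' i, hrep y' hy, ?_⟩
  have := congrArg V.subtype (b.sum_repr y')
  rw [map_sum] at this
  exact this.symm

/-- Points of an additive subgroup in the dilate by `T` of the box with half-widths `η`. -/
def boxPoints {ι : Type*} (L : AddSubgroup (ι → ℝ)) (η : ι → ℝ) (T : ℝ) : Set (ι → ℝ) :=
  {v | v ∈ L ∧ ∀ i, |v i| ≤ T * η i}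

theorem abs_sum_smul_apply_le {ι : Type*} {t : ℕ} {η : ι → ℝ} {f : Fin t → ι → ℝ}
    (hf : ∀ j i, |f j i| ≤ η i) {c : Fin t → ℝ} {r : ℝ} (hc : ∀ j, |c j| ≤ r) (i : ι) :
    |(∑ j, c j • f j) i| ≤ t * r * η i := by
  rw [Finset.sum_apply]
  calc |∑ j, (c j • f j) i| ≤ ∑ j, |(c j • f j) i| := abs_sum_le_sum_abs _ _
    _ ≤ ∑ _j : Fin t, r * η i := by
        refine sum_le_sum fun j _ => ?_
        rw [Pi.smul_apply, smul_eq_mul, abs_mul]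
        exact mul_le_mul (hc j) (hf j i) (abs_nonneg _) ((abs_nonneg _).trans (hc j))
    _ = t * r * η i := by simp [mul_assoc]

/-- Translating by many small combinations of independent lattice vectors: growth of the number
of lattice points in a dilated box. -/
theorem ncard_boxPoints_mul_le_of_dilate {ι : Type*} {L : AddSubgroup (ι → ℝ)}
    {η : ι → ℝ} {t m : ℕ} {T : ℝ} (hη : ∀ i, 0 ≤ η i) (h1 : (boxPoints L η 1).Finite)
    (hT : (boxPoints L η T).Finite) {f : Fin t → ι → ℝ} (hf : ∀ j, f j ∈ boxPoints L η 1)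
    (hli : LinearIndependent ℝ f)
    (hc : ∀ y ∈ boxPoints L η 1, ∃ c : Fin t → ℝ, (∀ j, |c j| ≤ 1) ∧ y = ∑ j, c j • f j)
    (hm : 1 + t * m ≤ T) :
    (boxPoints L η 1).ncard * (m + 1) ^ t ≤ 5 ^ t * (boxPoints L η T).ncard := by
  classical
  rw [Set.ncard_eq_toFinset_card _ h1, Set.ncard_eq_toFinset_card _ hT]
  let K : Finset (Fin t → ℕ) := Fintype.piFinset fun _ => range (m + 1)
  let F : (ι → ℝ) × (Fin t → ℕ) → ι → ℝ := fun q => q.1 + ∑ j, (q.2 j : ℝ) • f j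
  have hK : #K = (m + 1) ^ t := by simp [K]
  rw [← hK, ← card_product]
  refine card_le_mul_card_image_of_maps_to (f := F) ?_ _ ?_
  · rintro ⟨y, k⟩ hq
    rw [mem_product, Set.Finite.mem_toFinset] at hq
    rw [Set.Finite.mem_toFinset]
    refine ⟨L.add_mem hq.1.1 (L.sum_mem fun j _ => ?_), fun i => ?_⟩
    · rw [Nat.cast_smul_eq_nsmul]
      exact L.nsmul_mem (hf j).1 _
    · have hk : ∀ j, |(k j : ℝ)| ≤ m := fun j => by
        have := Fintype.mem_piFinset.1 hq.2 j
        rw [Finset.mem_range] at this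
        rw [Nat.abs_cast]
        exact_mod_cast Nat.lt_succ_iff.1 this
      have hs := abs_sum_smul_apply_le (η := η) (fun j i => by simpa using (hf j).2 i) hk i
      have hy := hq.1.2 i
      have := mul_le_mul_of_nonneg_right hm (hη i)
      calc |(y + ∑ j, (k j : ℝ) • f j) i| ≤ |y i| + |(∑ j, (k j : ℝ) • f j) i| := abs_add_le _ _
        _ ≤ T * η i := by linarith
  · intro z _
    set A := {q ∈ h1.toFinset ×ˢ K | F q = z} with hA
    rcases A.eq_empty_or_nonempty with h0 | ⟨⟨y₀, k₀⟩, hq₀⟩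
    · simp [h0]
    have hcard : #(Fintype.piFinset fun _ : Fin t => Icc (-2 : ℤ) 2) = 5 ^ t := by simp
    rw [← hcard]
    refine card_le_card_of_injOn (fun q j => (q.2 j : ℤ) - k₀ j) ?_ ?_
    · rintro ⟨y, k⟩ hq
      simp only [hA, coe_filter, mem_filter, mem_product, Set.Finite.mem_toFinset,
        Set.mem_ofPred_eq] at hq hq₀
      obtain ⟨c, hc1, hcy⟩ := hc y hq.1.1
      obtain ⟨c₀, hc1₀, hcy₀⟩ := hc y₀ hq₀.1.1
      have hzero : ∑ j, ((c j + k j) - (c₀ j + k₀ j)) • f j = 0 := by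
        have := hq.2.trans hq₀.2.symm
        simp only [F] at this
        rw [hcy, hcy₀, ← sum_add_distrib, ← sum_add_distrib] at this
        simp only [sub_smul, add_smul, sum_sub_distrib]
        exact sub_eq_zero.2 this
      rw [mem_coe, Fintype.mem_piFinset]
      intro j
      have hj := Fintype.linearIndependent_iff.1 hli _ hzero j
      have h1 := abs_le.1 (hc1 j)
      have h2 := abs_le.1 (hc1₀ j)
      rw [mem_Icc]
      constructor
      · have : (-2 : ℝ) ≤ k j - k₀ j := by linarith
        exact_mod_cast this
      · have : (k j - k₀ j : ℝ) ≤ 2 := by linarith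
        exact_mod_cast this
    · rintro ⟨y, k⟩ hq ⟨y', k'⟩ hq' h
      simp only [hA, coe_filter, Set.mem_ofPred_eq] at hq hq'
      have hk : k = k' := by
        funext j
        have := congrFun h j
        simp only at this
        omega
      subst hk
      have := hq.2.trans hq'.2.symm
      simp only [F, add_left_inj] at this
      rw [this]

/-- Pigeonholing coordinates: a box is covered by boundedly many translates of a smaller one. -/
theorem ncard_boxPoints_le_of_shrink {ι : Type*} {L : AddSubgroup (ι → ℝ)}
    {η : ι → ℝ} {t M : ℕ} {T : ℝ} (hη : ∀ i, 0 ≤ η i) (h1 : (boxPoints L η 1).Finite)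
    (hT : (boxPoints L η T).Finite) {f : Fin t → ι → ℝ} (hf : ∀ j, f j ∈ boxPoints L η 1)
    (hc : ∀ y ∈ boxPoints L η 1, ∃ c : Fin t → ℝ, (∀ j, |c j| ≤ 1) ∧ y = ∑ j, c j • f j)
    (hM0 : 0 < M) (hM : t ≤ T * M) :
    (boxPoints L η 1).ncard ≤ (boxPoints L η T).ncard * (2 * M + 1) ^ t := by
  classical
  have hM0' : (0 : ℝ) < M := by exact_mod_cast hM0
  rw [Set.ncard_eq_toFinset_card _ h1, Set.ncard_eq_toFinset_card _ hT]
  choose! c hc1 hcy using hc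
  have hcard : #(Fintype.piFinset fun _ : Fin t => Icc (-M : ℤ) M) = (2 * M + 1) ^ t := by
    simp only [Fintype.card_piFinset, Int.card_Icc, prod_const, card_univ, Fintype.card_fin]
    congr 1
    omega
  rw [← hcard]
  refine card_le_mul_card_image_of_maps_to (f := fun y j => ⌊c y j * M⌋) ?_ _ ?_
  · intro y hy
    rw [Set.Finite.mem_toFinset] at hy
    rw [Fintype.mem_piFinset]
    intro j
    have h := abs_le.1 (hc1 y hy j)
    rw [mem_Icc, Int.le_floor]
    constructor
    · push_cast
      nlinarith
    · have : (⌊c y j * M⌋ : ℝ) ≤ M := (Int.floor_le _).trans (by nlinarith)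
      exact_mod_cast this
  · intro z _
    set A := {y ∈ h1.toFinset | (fun j => ⌊c y j * M⌋) = z} with hA
    rcases A.eq_empty_or_nonempty with h0 | ⟨y₀, hy₀⟩
    · simp [h0]
    refine card_le_card_of_injOn (fun y => y - y₀) ?_ (fun _ _ _ _ h => sub_left_injective h)
    intro y hy
    simp only [hA, mem_coe, mem_filter, Set.Finite.mem_toFinset] at hy hy₀
    rw [mem_coe, Set.Finite.mem_toFinset]
    refine ⟨L.sub_mem hy.1.1 hy₀.1.1, fun i => ?_⟩
    have hdiff : y - y₀ = ∑ j, (c y j - c y₀ j) • f j := by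
      conv_lhs => rw [hcy y hy.1, hcy y₀ hy₀.1]
      simp only [sub_smul, sum_sub_distrib]
    have hsmall : ∀ j, |c y j - c y₀ j| ≤ 1 / M := fun j => by
      have h := Int.abs_sub_lt_one_of_floor_eq_floor
        (congrFun (hy.2.trans hy₀.2.symm) j)
      rw [← sub_mul, abs_mul, Nat.abs_cast] at h
      rw [le_div_iff₀ hM0']
      exact h.le
    simp only
    rw [hdiff]
    refine (abs_sum_smul_apply_le (η := η) (fun j i => by simpa using (hf j).2 i)
      hsmall i).trans (mul_le_mul_of_nonneg_right ?_ (hη i))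
    rw [mul_one_div, div_le_iff₀ hM0']
    exact hM

/-- Lattice points in a box compared with those in a dilate, in terms of the dimension they span. -/
theorem ncard_boxPoints_mul_pow_le {ι : Type*} [Fintype ι] {L : AddSubgroup (ι → ℝ)} {η : ι → ℝ}
    {T : ℝ} (hη : ∀ i, 0 ≤ η i) (hT0 : 0 < T) (h1 : (boxPoints L η 1).Finite)
    (hT : (boxPoints L η T).Finite) :
    ((boxPoints L η 1).ncard : ℝ) *
        T ^ Module.finrank ℝ (Submodule.span ℝ (boxPoints L η 1)) ≤
      (5 * (Fintype.card ι + 2)) ^ Module.finrank ℝ (Submodule.span ℝ (boxPoints L η 1)) *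
        (boxPoints L η T).ncard := by
  obtain ⟨f, hf, hli, hc⟩ := exists_linearIndependent_abs_coeff_le_one h1
  have ht : Module.finrank ℝ (Submodule.span ℝ (boxPoints L η 1)) ≤ Fintype.card ι := by
    simpa using Submodule.finrank_le (Submodule.span ℝ (boxPoints L η 1))
  generalize Module.finrank ℝ (Submodule.span ℝ (boxPoints L η 1)) = t at *
  set d : ℝ := (Fintype.card ι : ℝ)
  have hd0 : 0 ≤ d := Nat.cast_nonneg _
  have htd : (t : ℝ) ≤ d := Nat.cast_le.2 ht
  rcases le_total 1 T with h | h
  · set m := ⌊(T - 1) / (d + 1)⌋₊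
    have hm1 : (m : ℝ) * (d + 1) ≤ T - 1 := by
      rw [← le_div_iff₀ (by linarith)]
      exact Nat.floor_le (div_nonneg (by linarith) (by linarith))
    have hm2 : T - 1 < (m + 1) * (d + 1) := by
      rw [← div_lt_iff₀ (by linarith)]
      exact Nat.lt_floor_add_one _
    have hm0 : (0 : ℝ) ≤ m := Nat.cast_nonneg m
    have key := ncard_boxPoints_mul_le_of_dilate (m := m) hη h1 hT hf hli hc
      (by nlinarith)
    have key' : ((boxPoints L η 1).ncard : ℝ) * (m + 1) ^ t ≤
        5 ^ t * (boxPoints L η T).ncard := by exact_mod_cast key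
    calc ((boxPoints L η 1).ncard : ℝ) * T ^ t
        ≤ (boxPoints L η 1).ncard * ((d + 2) * (m + 1)) ^ t := by
          gcongr
          nlinarith
      _ = (d + 2) ^ t * ((boxPoints L η 1).ncard * (m + 1) ^ t) := by rw [mul_pow]; ring
      _ ≤ (d + 2) ^ t * (5 ^ t * (boxPoints L η T).ncard) := by gcongr
      _ = _ := by rw [mul_pow]; ring
  · set M := ⌈(d + 1) / T⌉₊
    have hM0 : 0 < M := Nat.ceil_pos.2 (by positivity)
    have hM1 : d + 1 ≤ T * M := by
      rw [← div_le_iff₀' hT0]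
      exact Nat.le_ceil _
    have hM2 : T * M ≤ d + 2 := by
      have := (Nat.ceil_lt_add_one (show 0 ≤ (d + 1) / T by positivity)).le
      calc T * M ≤ T * ((d + 1) / T + 1) := by gcongr
        _ = d + 1 + T := by field_simp
        _ ≤ d + 2 := by linarith
    have key := ncard_boxPoints_le_of_shrink hη h1 hT hf hc hM0 (by linarith)
    have key' : ((boxPoints L η 1).ncard : ℝ) ≤
        (boxPoints L η T).ncard * (2 * M + 1) ^ t := by exact_mod_cast key
    calc ((boxPoints L η 1).ncard : ℝ) * T ^ t
        ≤ (boxPoints L η T).ncard * (2 * M + 1) ^ t * T ^ t := by gcongr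
      _ = (T * (2 * M + 1)) ^ t * (boxPoints L η T).ncard := by rw [mul_pow]; ring
      _ ≤ _ := by
          have : T * (2 * M + 1) ≤ 5 * (d + 2) := by linarith
          gcongr

/-- The lattice `ℤ^d + {p⁻¹(a₁x, …, a_dx) : x ∈ ℤ}`. -/
def bohrLattice (p : ℕ) {ι : Type*} (a : ι → ZMod p) : AddSubgroup (ι → ℝ) where
  carrier := {v | ∃ (n : ι → ℤ) (x : ℤ),
    v = fun i => (n i : ℝ) + (((a i).val : ℝ) * (x : ℝ)) / p}
  zero_mem' := ⟨0, 0, by ext; simp⟩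
  add_mem' := by
    rintro _ _ ⟨n, x, rfl⟩ ⟨m, y, rfl⟩
    exact ⟨n + m, x + y, by ext; simp; ring⟩
  neg_mem' := by
    rintro _ ⟨n, x, rfl⟩
    exact ⟨-n, -x, by ext; simp; ring⟩

theorem exists_int_add_val_mul_div {p : ℕ} [NeZero p] (a : ZMod p) (x : ℤ) :
    ∃ n : ℤ, ((a.val : ℝ) * x) / p = n + ((a * (x : ZMod p)).val : ℝ) / p := by
  have hp : (p : ℝ) ≠ 0 := Nat.cast_ne_zero.2 (NeZero.ne p)
  have h : ((a.val * x - (a * (x : ZMod p)).val : ℤ) : ZMod p) = 0 := by simp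
  obtain ⟨n, hn⟩ := (ZMod.intCast_zmod_eq_zero_iff_dvd _ p).1 h
  refine ⟨n, ?_⟩
  have hn' : (a.val : ℝ) * x - (a * (x : ZMod p)).val = p * n := by exact_mod_cast hn
  field_simp
  linarith

theorem mem_bohrLattice_iff {p : ℕ} [NeZero p] {ι : Type*} {a : ι → ZMod p} {v : ι → ℝ} :
    v ∈ bohrLattice p a ↔
      ∃ (n : ι → ℤ) (x : ZMod p), v = fun i => n i + ((a i * x).val : ℝ) / p := by
  constructor
  · rintro ⟨n, x, rfl⟩
    choose m hm using fun i => exists_int_add_val_mul_div (a i) x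
    refine ⟨n + m, x, funext fun i => ?_⟩
    rw [hm]
    simp [add_assoc]
  · rintro ⟨n, x, rfl⟩
    choose m hm using fun i => exists_int_add_val_mul_div (a i) x.val
    refine ⟨n - m, x.val, funext fun i => ?_⟩
    rw [hm, Int.cast_natCast, ZMod.natCast_zmod_val]
    simp only [Pi.sub_apply, Int.cast_sub]
    ring

/-- The residues whose multiples `aᵢx/p` all lie within `wᵢ` of an integer. -/
def bohrSet (p : ℕ) {ι : Type*} (a : ι → ZMod p) (w : ι → ℝ) : Set (ZMod p) :=
  {x | ∀ i, ∃ n : ℤ, |n + ((a i * x).val : ℝ) / p| ≤ w i}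

theorem card_Icc_ceil_floor_le {w : ℝ} (hw : 0 ≤ w) (θ : ℝ) :
    (#(Icc ⌈-w - θ⌉ ⌊w - θ⌋) : ℝ) ≤ 2 * w + 1 := by
  rw [Int.card_Icc]
  have h1 := Int.le_ceil (-w - θ)
  have h2 := Int.floor_le (w - θ)
  rcases le_total 0 (⌊w - θ⌋ + 1 - ⌈-w - θ⌉) with h | h
  · have : (((⌊w - θ⌋ + 1 - ⌈-w - θ⌉).toNat : ℤ) : ℝ) = ⌊w - θ⌋ + 1 - ⌈-w - θ⌉ := by
      rw [Int.toNat_of_nonneg h]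
      push_cast
      ring
    rw [Int.cast_natCast] at this
    linarith
  · rw [Int.toNat_of_nonpos h]
    simp only [Nat.cast_zero]
    linarith

theorem finite_boxPoints_bohrLattice {p : ℕ} [NeZero p] {ι : Type*} [Fintype ι]
    (a : ι → ZMod p) {η : ι → ℝ} {T : ℝ} (hw : ∀ i, 0 ≤ T * η i) :
    (boxPoints (bohrLattice p a) η T).Finite ∧
      ((boxPoints (bohrLattice p a) η T).ncard : ℝ) ≤
        (bohrSet p a fun i => T * η i).ncard * ∏ i, (2 * (T * η i) + 1) := by
  classical
  set w : ι → ℝ := fun i => T * η i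
  have hG : (bohrSet p a w).Finite := Set.toFinite _
  let N : ZMod p → Finset (ι → ℤ) := fun x => Fintype.piFinset fun i =>
    Icc ⌈-w i - ((a i * x).val : ℝ) / p⌉ ⌊w i - ((a i * x).val : ℝ) / p⌋
  let A : Finset (ι → ℝ) := hG.toFinset.biUnion fun x =>
    (N x).image fun n i => n i + ((a i * x).val : ℝ) / p
  have hsub : boxPoints (bohrLattice p a) η T ⊆ A := by
    rintro v ⟨hv, hvw⟩
    obtain ⟨n, x, rfl⟩ := mem_bohrLattice_iff.1 hv
    rw [mem_coe, mem_biUnion]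
    refine ⟨x, hG.mem_toFinset.2 fun i => ⟨n i, hvw i⟩, mem_image.2 ⟨n, ?_, rfl⟩⟩
    refine Fintype.mem_piFinset.2 fun i => mem_Icc.2 ?_
    have := abs_le.1 (hvw i)
    rw [Int.ceil_le, Int.le_floor]
    constructor <;> simp only [w] <;> linarith
  refine ⟨A.finite_toSet.subset hsub, ?_⟩
  have hcard : (boxPoints (bohrLattice p a) η T).ncard ≤ #A := by
    rw [← Set.ncard_coe_finset]
    exact Set.ncard_le_ncard hsub A.finite_toSet
  calc ((boxPoints (bohrLattice p a) η T).ncard : ℝ) ≤ #A := by exact_mod_cast hcard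
    _ ≤ ∑ x ∈ hG.toFinset, (#(N x) : ℝ) := by
        exact_mod_cast card_biUnion_le.trans (sum_le_sum fun x _ => card_image_le)
    _ ≤ ∑ x ∈ hG.toFinset, ∏ i, (2 * w i + 1) := by
        refine sum_le_sum fun x _ => ?_
        rw [Fintype.card_piFinset, Nat.cast_prod]
        exact prod_le_prod (fun _ _ => Nat.cast_nonneg _)
          fun i _ => card_Icc_ceil_floor_le (hw i) _
    _ = _ := by rw [sum_const, nsmul_eq_mul, Set.ncard_eq_toFinset_card _ hG]

theorem stdAddChar_natCast_mul_re_ge {p : ℕ} [NeZero p] {y : ZMod p} {n : ℤ} {k : ℕ}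
    (h : k * |n + (y.val : ℝ) / p| ≤ 1 / 6) :
    1 / 2 ≤ (ZMod.stdAddChar ((k : ZMod p) * y)).re := by
  have hp : (p : ℝ) ≠ 0 := Nat.cast_ne_zero.2 (NeZero.ne p)
  have hy : ((k : ZMod p) * y) = ((k * (n * p + y.val) : ℤ) : ZMod p) := by simp
  have hexp : (2 * Real.pi * Complex.I * ((k * (n * p + y.val) : ℤ) : ℂ) / p : ℂ) =
      ((2 * Real.pi * (k * (n + (y.val : ℝ) / p)) : ℝ) : ℂ) * Complex.I := by
    have hp' : (p : ℂ) ≠ 0 := Nat.cast_ne_zero.2 (NeZero.ne p)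
    push_cast
    field_simp
  rw [hy, ZMod.stdAddChar_coe, hexp, Complex.exp_ofReal_mul_I_re, ← Real.cos_pi_div_three,
    ← Real.cos_abs (2 * Real.pi * _)]
  have habs : |2 * Real.pi * (k * (n + (y.val : ℝ) / p))| =
      2 * Real.pi * (k * |n + (y.val : ℝ) / p|) := by
    rw [abs_mul, abs_mul (k : ℝ), Nat.abs_cast, abs_of_pos Real.two_pi_pos]
  apply Real.cos_le_cos_of_nonneg_of_le_pi (abs_nonneg _) (by linarith [Real.pi_pos])
  rw [habs]
  nlinarith [Real.pi_pos]

/-- Parseval's identity for the exponential sum of a set of distinct frequencies. -/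
theorem sum_norm_sq_sum_stdAddChar {p : ℕ} [NeZero p] {κ : Type*} {Q : Finset κ} {g : κ → ZMod p}
    (hg : Set.InjOn g Q) :
    ∑ x : ZMod p, ‖∑ k ∈ Q, ZMod.stdAddChar (x * g k)‖ ^ 2 = p * #Q := by
  classical
  have hC : ∑ x : ZMod p, (‖∑ k ∈ Q, ZMod.stdAddChar (x * g k)‖ ^ 2 : ℂ) = p * #Q := by
    calc ∑ x : ZMod p, (‖∑ k ∈ Q, ZMod.stdAddChar (x * g k)‖ ^ 2 : ℂ)
        = ∑ x : ZMod p, ∑ k ∈ Q, ∑ l ∈ Q, ZMod.stdAddChar (x * (g k - g l)) := by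
          refine sum_congr rfl fun x _ => ?_
          rw [← Complex.mul_conj', map_sum, sum_mul_sum]
          refine sum_congr rfl fun k _ => sum_congr rfl fun l _ => ?_
          rw [← AddChar.map_neg_eq_conj, ← AddChar.map_add_eq_mul]
          congr 1
          ring
      _ = ∑ k ∈ Q, ∑ l ∈ Q, ∑ x : ZMod p, ZMod.stdAddChar (x * (g k - g l)) := by
          rw [sum_comm]
          exact sum_congr rfl fun k _ => sum_comm
      _ = ∑ k ∈ Q, ∑ l ∈ Q, if k = l then (p : ℂ) else 0 := by
          refine sum_congr rfl fun k hk => sum_congr rfl fun l hl => ?_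
          rw [AddChar.sum_mulShift _ (ZMod.isPrimitive_stdAddChar p)]
          simp [sub_eq_zero, hg.eq_iff hk hl]
      _ = p * #Q := by
          simp [mul_comm]
  exact_mod_cast hC

theorem addChar_map_sum {A M ι : Type*} [AddCommMonoid A] [CommMonoid M] (ψ : AddChar A M)
    (s : Finset ι) (f : ι → A) : ψ (∑ i ∈ s, f i) = ∏ i ∈ s, ψ (f i) := by
  classical
  induction s using Finset.induction_on with
  | empty => simp
  | insert i s hi ih => rw [sum_insert hi, prod_insert hi, AddChar.map_add_eq_mul, ih]

/-- Large sieve bound for a Bohr set whose frequencies satisfy no short linear relation. -/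
theorem ncard_bohrSet_mul_prod_le {p : ℕ} [NeZero p] {ι : Type*} [Fintype ι] {a : ι → ZMod p}
    {w : ι → ℝ} {N : ι → ℕ} (hw : ∀ i, N i * w i ≤ 1 / 6)
    (hrel : ∀ u : ι → ℤ, (∀ i, |u i| ≤ N i) → ∑ i, a i * (u i : ZMod p) = 0 → u = 0) :
    ((bohrSet p a w).ncard : ℝ) * ∏ i, ((N i : ℝ) + 1) ≤ 4 ^ Fintype.card ι * p := by
  classical
  have hG : (bohrSet p a w).Finite := Set.toFinite _
  let Q : Finset (ι → ℕ) := Fintype.piFinset fun i => range (N i + 1)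
  let g : (ι → ℕ) → ZMod p := fun k => ∑ i, a i * k i
  have hQ : (#Q : ℝ) = ∏ i, ((N i : ℝ) + 1) := by simp [Q]
  have hQ0 : (0 : ℝ) < #Q := by
    rw [hQ]
    exact prod_pos fun i _ => by positivity
  have hg : Set.InjOn g Q := by
    intro k hk l hl hkl
    rw [mem_coe, Fintype.mem_piFinset] at hk hl
    have h := hrel (fun i => (k i : ℤ) - l i) (fun i => ?_) ?_
    · funext i
      have := congrFun h i
      simp only [Pi.zero_apply] at this
      omega
    · have h1 := hk i
      have h2 := hl i
      rw [Finset.mem_range] at h1 h2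
      rw [abs_le]
      omega
    · simp only [Int.cast_sub, Int.cast_natCast, mul_sub, sum_sub_distrib]
      exact sub_eq_zero.2 hkl
  have hlow : ∀ x ∈ bohrSet p a w,
      (#Q : ℝ) ^ 2 / 4 ^ Fintype.card ι ≤ ‖∑ k ∈ Q, ZMod.stdAddChar (x * g k)‖ ^ 2 := by
    intro x hx
    have hfac : ∑ k ∈ Q, ZMod.stdAddChar (x * g k) =
        ∏ i, ∑ k ∈ range (N i + 1), ZMod.stdAddChar ((k : ZMod p) * (a i * x)) := by
      rw [prod_univ_sum]
      refine sum_congr rfl fun k _ => ?_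
      rw [← addChar_map_sum, mul_sum]
      exact congrArg _ (sum_congr rfl fun i _ => by ring)
    have hone : ∀ i, ((N i : ℝ) + 1) / 2 ≤
        ‖∑ k ∈ range (N i + 1), ZMod.stdAddChar ((k : ZMod p) * (a i * x))‖ := by
      intro i
      refine le_trans ?_ (Complex.re_le_norm _)
      rw [Complex.re_sum]
      obtain ⟨n, hn⟩ := hx i
      calc ((N i : ℝ) + 1) / 2 = ∑ k ∈ range (N i + 1), (1 / 2 : ℝ) := by simp; ring
        _ ≤ _ := by
          refine sum_le_sum fun k hk => stdAddChar_natCast_mul_re_ge (n := n) ?_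
          have hk' : (k : ℝ) ≤ N i := by
            exact_mod_cast Nat.lt_succ_iff.1 (Finset.mem_range.1 hk)
          exact (mul_le_mul hk' hn (abs_nonneg _) (Nat.cast_nonneg _)).trans (hw i)
    have hprod : (#Q : ℝ) / 2 ^ Fintype.card ι ≤ ‖∑ k ∈ Q, ZMod.stdAddChar (x * g k)‖ := by
      rw [hfac, norm_prod, hQ]
      calc (∏ i, ((N i : ℝ) + 1)) / 2 ^ Fintype.card ι = ∏ i, ((N i : ℝ) + 1) / 2 := by
            rw [prod_div_distrib]
            simp
        _ ≤ _ := prod_le_prod (fun i _ => by positivity) fun i _ => hone i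
    calc (#Q : ℝ) ^ 2 / 4 ^ Fintype.card ι = ((#Q : ℝ) / 2 ^ Fintype.card ι) ^ 2 := by
          rw [div_pow, ← pow_mul, mul_comm _ 2, pow_mul]
          norm_num
      _ ≤ _ := by gcongr
  have hsum : ((bohrSet p a w).ncard : ℝ) * ((#Q : ℝ) ^ 2 / 4 ^ Fintype.card ι) ≤ p * #Q := by
    rw [← sum_norm_sq_sum_stdAddChar hg, Set.ncard_eq_toFinset_card _ hG, ← nsmul_eq_mul]
    exact (card_nsmul_le_sum _ _ _ fun x hx => hlow x (hG.mem_toFinset.1 hx)).trans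
      (sum_le_sum_of_subset_of_nonneg (subset_univ _) fun _ _ _ => by positivity)
  rw [← hQ]
  rw [← mul_div_assoc, div_le_iff₀ (by positivity)] at hsum
  refine le_of_mul_le_mul_right ?_ hQ0
  linarith

/-- Lattice points of the Bohr lattice in the box dilated by `1/(6δ)`. -/
theorem ncard_boxPoints_bohrLattice_le {p : ℕ} [NeZero p] {ι : Type*} [Fintype ι]
    {a : ι → ZMod p} {η : ι → ℝ} (hη : ∀ i, 0 < η i) {δ : ℝ} (hδ : 0 < δ)
    (hrel : ∀ u : ι → ℤ, (∀ i, |(u i : ℝ)| ≤ δ / η i) →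
      ∑ i, a i * (u i : ZMod p) = 0 → u = 0) :
    ((boxPoints (bohrLattice p a) η (1 / (6 * δ))).ncard : ℝ) ≤
      4 ^ Fintype.card ι * p * ∏ i, (2 * η i / δ) := by
  let N : ι → ℕ := fun i => ⌊δ / η i⌋₊
  have hN : ∀ i, (N i : ℝ) ≤ δ / η i := fun i => Nat.floor_le (div_pos hδ (hη i)).le
  have hw : ∀ i, (N i : ℝ) * (1 / (6 * δ) * η i) ≤ 1 / 6 := fun i => by
    have := hη i
    calc (N i : ℝ) * (1 / (6 * δ) * η i) ≤ δ / η i * (1 / (6 * δ) * η i) := by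
          gcongr
          exact hN i
      _ = 1 / 6 := by field_simp
  have hsieve := ncard_bohrSet_mul_prod_le hw fun u hu => hrel u fun i => by
    have h : |(u i : ℝ)| ≤ N i := by exact_mod_cast hu i
    exact h.trans (hN i)
  have hfactor : ∀ i, 2 * (1 / (6 * δ) * η i) + 1 ≤ ((N i : ℝ) + 1) * (2 * η i / δ) := by
    intro i
    have hlt : δ / η i < N i + 1 := Nat.lt_floor_add_one _
    have hpos : 0 < η i / δ := div_pos (hη i) hδ
    have h1 : 1 ≤ ((N i : ℝ) + 1) * (η i / δ) := by
      calc (1 : ℝ) = δ / η i * (η i / δ) := by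
            have := (hη i).ne'
            field_simp
        _ ≤ _ := by gcongr
    have h2 : 2 * (1 / (6 * δ) * η i) = (1 / 3) * (η i / δ) := by
      field_simp
      ring
    have h3 : 0 ≤ (N i : ℝ) * (η i / δ) := by positivity
    rw [h2, mul_div_assoc]
    nlinarith
  refine (finite_boxPoints_bohrLattice a fun i => ?_).2.trans ?_
  · have := hη i
    positivity
  calc ((bohrSet p a fun i => 1 / (6 * δ) * η i).ncard : ℝ) *
        ∏ i, (2 * (1 / (6 * δ) * η i) + 1)
      ≤ (bohrSet p a fun i => 1 / (6 * δ) * η i).ncard *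
        ∏ i, (((N i : ℝ) + 1) * (2 * η i / δ)) := by
        refine mul_le_mul_of_nonneg_left (prod_le_prod (fun i _ => ?_) fun i _ => hfactor i)
          (Nat.cast_nonneg _)
        have := hη i
        positivity
    _ = ((bohrSet p a fun i => 1 / (6 * δ) * η i).ncard * ∏ i, ((N i : ℝ) + 1)) *
        ∏ i, (2 * η i / δ) := by rw [prod_mul_distrib, mul_assoc]
    _ ≤ _ := by
        refine mul_le_mul_of_nonneg_right hsieve (prod_nonneg fun i _ => ?_)
        have := hη i
        positivity

theorem ncard_le_ncard_boxPoints {p : ℕ} [Fact p.Prime] {ι : Type*} [Nonempty ι] {a : ι → ZMod p}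
    (ha : ∀ i, a i ≠ 0) {η : ι → ℝ} (hfin : (boxPoints (bohrLattice p a) η 1).Finite) :
    {x : ZMod p | ∀ i, distToInt (((a i * x).val : ℝ) / p) ≤ η i}.ncard ≤
      (boxPoints (bohrLattice p a) η 1).ncard := by
  have hp : (0 : ℝ) < p := Nat.cast_pos.2 (Fact.out : p.Prime).pos
  refine Set.ncard_le_ncard_of_injOn
    (fun x i => ((a i * x).val : ℝ) / p - round (((a i * x).val : ℝ) / p)) ?_ ?_ hfin
  · intro x hx
    refine ⟨mem_bohrLattice_iff.2 ⟨fun i => -round (((a i * x).val : ℝ) / p), x, ?_⟩, fun i => ?_⟩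
    · funext i
      push_cast
      ring
    · rw [one_mul]
      exact hx i
  · intro x _ y _ hxy
    obtain ⟨i⟩ := ‹Nonempty ι›
    have h := congrFun hxy i
    simp only at h
    have hfr : ∀ z : ZMod p, Int.fract ((z.val : ℝ) / p) = (z.val : ℝ) / p := fun z => by
      rw [Int.fract_eq_self]
      refine ⟨by positivity, ?_⟩
      rw [div_lt_one hp]
      exact_mod_cast ZMod.val_lt z
    replace h := congrArg Int.fract h
    rw [Int.fract_sub_intCast, Int.fract_sub_intCast, hfr, hfr, div_left_inj' hp.ne'] at h
    exact mul_left_cancel₀ (ha i) (ZMod.val_injective p (by exact_mod_cast h))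

/-- **Upper bound for Bohr sets.**
For every d ≥ 1 there is C_d > 0 such that: for every prime p, frequencies
a₁, …, a_d ∈ F_p ∖ {0}, widths η₁, …, η_d ∈ (0, 1/2), with the Bohr set
B = {x ∈ F_p : ‖aᵢx/p‖ ≤ ηᵢ ∀i}, the box R = ∏ [−ηᵢ, ηᵢ], the lattice
L = ℤ^d + {p⁻¹(a₁x, …, a_dx) : x ∈ ℤ}, t the maximal number of ℝ-linearly
independent vectors in R ∩ L, and δ > 0 such that the only integer solution of
a₁u₁ + ⋯ + a_du_d ≡ 0 (mod p) with |uᵢ| ≤ δ/ηᵢ is u = 0, one has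
|B| ≤ C_d · δ^(t−d) · (η₁⋯η_d) · p. -/
theorem stmt2 (d : ℕ) (hd : 0 < d) :
    ∃ C : ℝ, 0 < C ∧
      ∀ (p : ℕ), p.Prime →
      ∀ (a : Fin d → ZMod p), (∀ i, a i ≠ 0) →
      ∀ (η : Fin d → ℝ), (∀ i, 0 < η i ∧ η i < 1 / 2) →
      ∀ (δ : ℝ), 0 < δ →
        (∀ u : Fin d → ℤ, (∀ i, |(u i : ℝ)| ≤ δ / η i) →
          (∑ i, a i * (u i : ZMod p)) = 0 → u = 0) →
      ∀ (B : Set (ZMod p)),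
        B = {x : ZMod p | ∀ i, distToInt (((a i * x).val : ℝ) / p) ≤ η i} →
      ∀ (R L : Set (Fin d → ℝ)),
        R = {v | ∀ i, |v i| ≤ η i} →
        L = {v | ∃ (n : Fin d → ℤ) (x : ℤ),
              v = fun i => (n i : ℝ) + (((a i).val : ℝ) * (x : ℝ)) / p} →
      ∀ (t : ℕ), t = Module.finrank ℝ (Submodule.span ℝ (R ∩ L)) →
        (B.ncard : ℝ) ≤ C * δ ^ ((t : ℤ) - d) * (∏ i, η i) * p := by
  refine ⟨(5 * (d + 2) * 6) ^ d * 8 ^ d, by positivity, ?_⟩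
  rintro p hp a ha η hη δ hδ hrel _ rfl _ _ rfl rfl t ht
  have : Fact p.Prime := ⟨hp⟩
  have : Nonempty (Fin d) := ⟨⟨0, hd⟩⟩
  have hη0 : ∀ i, 0 ≤ η i := fun i => (hη i).1.le
  have hset : ({v | ∀ i, |v i| ≤ η i} ∩ {v | ∃ (n : Fin d → ℤ) (x : ℤ),
      v = fun i => (n i : ℝ) + (((a i).val : ℝ) * (x : ℝ)) / p} : Set (Fin d → ℝ)) =
      boxPoints (bohrLattice p a) η 1 := by
    ext v
    simp only [boxPoints, one_mul]
    exact and_comm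
  rw [hset] at ht
  have hT0 : 0 < 1 / (6 * δ) := by positivity
  have hfin := (finite_boxPoints_bohrLattice a (T := 1) fun i => by simpa using hη0 i).1
  have hfinT := (finite_boxPoints_bohrLattice a fun i => mul_nonneg hT0.le (hη0 i)).1
  have hB := ncard_le_ncard_boxPoints ha hfin
  have hgrow := ncard_boxPoints_mul_pow_le hη0 hT0 hfin hfinT
  have hcount := ncard_boxPoints_bohrLattice_le (fun i => (hη i).1) hδ hrel
  have htd : t ≤ d := by
    rw [ht]
    simpa using Submodule.finrank_le (Submodule.span ℝ (boxPoints (bohrLattice p a) η 1))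
  rw [← ht, one_div, inv_pow, ← div_eq_mul_inv, div_le_iff₀ (by positivity)] at hgrow
  simp only [Fintype.card_fin] at hgrow hcount
  have hprod : ∏ i, (2 * η i / δ) = 2 ^ d * (∏ i, η i) / δ ^ d := by
    simp [prod_div_distrib, prod_mul_distrib]
  rw [hprod, one_div] at hcount
  have hη1 : 0 ≤ ∏ i, η i := prod_nonneg fun i _ => hη0 i
  have hK : (5 * ((d : ℝ) + 2) * 6) ^ t ≤ (5 * ((d : ℝ) + 2) * 6) ^ d :=
    pow_le_pow_right₀ (by linarith [(Nat.cast_nonneg d : (0 : ℝ) ≤ d)]) htd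
  calc _ ≤ ((boxPoints (bohrLattice p a) η 1).ncard : ℝ) := by exact_mod_cast hB
    _ ≤ _ := hgrow
    _ ≤ (5 * ((d : ℝ) + 2)) ^ t * (4 ^ d * p * (2 ^ d * (∏ i, η i) / δ ^ d)) * (6 * δ) ^ t := by
        gcongr
    _ = (5 * ((d : ℝ) + 2) * 6) ^ t * (4 * 2) ^ d * (δ ^ t / δ ^ d) * (∏ i, η i) * p := by
        simp only [mul_pow]
        ring
    _ = (5 * ((d : ℝ) + 2) * 6) ^ t * 8 ^ d * δ ^ ((t : ℤ) - d) * (∏ i, η i) * p := by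
        rw [zpow_sub₀ hδ.ne', zpow_natCast, zpow_natCast]
        norm_num
    _ ≤ _ := by gcongr
end
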